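/- arXiv:2407.03464 — 2 statements merged into one kernel-verified Lean document; each statement's English description precedes it below -/
import Mathlib

section
/- For all ζ ∈ ℝ and ω ∈ ℂ with 0 < Im ω < 1/2, the function f_𝓜 satisfies the partial differential equations ∂f_𝓜(ζ,ω)/∂ζ = 2iπ(ζ+ω) + π − i·Log(1 − e^{2π(ζ+ω)}) and ∂f_𝓜(ζ,ω)/∂ω = π + 2iπζ − i·Log((1 − e^{2π(ζ+ω)})/(1 + e^{2πω})), where Log denotes the principal logarithm. -/
open MeasureTheory

noncomputable section

/-- The dilogarithm `Li₂(z) = -∫₀¹ Log(1 - t z) dt / t` (principal branch of `Log`). -/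
def Li2 (z : ℂ) : ℂ := -∫ t in (0:ℝ)..1, Complex.log (1 - (t:ℂ) * z) / (t:ℂ)

/-- Negative-index polylogarithms: `LiNeg m = Li_{-m}`, with `Li₀(w) = w/(1-w)` and
`Li_{-m}(w) = w ⬝ d/dw Li_{-m+1}(w)`. -/
def LiNeg : ℕ → ℂ → ℂ
  | 0 => fun w => w / (1 - w)
  | (m+1) => fun w => w * deriv (LiNeg m) w

/-- `LiIdx n = Li_{2-2n}`: the dilogarithm for `n = 0`, and `Li_{-(2n-2)}` for `n ≥ 1`. -/
def LiIdx (n : ℕ) : ℂ → ℂ := if n = 0 then Li2 else LiNeg (2*n - 2)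

/-- `L_b(z) = i ∫₀^∞ ( sin(2yz)/(2 sinh(y/b) sinh(by)) - z/y ) dy/y`. -/
def Lb (b : ℝ) (z : ℂ) : ℂ :=
  Complex.I * ∫ y in Set.Ioi (0:ℝ),
    (Complex.sin (2 * (y:ℂ) * z) / (2 * (Real.sinh (y / b) : ℂ) * (Real.sinh (b * y) : ℂ))
      - z / (y:ℂ)) / (y:ℂ)

/-- Ruijsenaars' hyperbolic gamma function `s_b(z) = exp(L_b(z))`. -/
def sb (b : ℝ) (z : ℂ) : ℂ := Complex.exp (Lb b z)

/-- `Q = b + b⁻¹` as a complex number. -/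
def Qb (b : ℝ) : ℂ := (b:ℂ) + (b:ℂ)⁻¹

/-- The function `𝓜(b, ζ', ω')`, the contour being the horizontal line `Im = -Q/4`. -/
def Mfun (b : ℝ) (ζ : ℝ) (ω : ℂ) : ℂ :=
  sb b ζ * ∫ x : ℝ,
    Complex.exp (Complex.I * (Real.pi:ℂ) * ((x:ℂ) - Complex.I * Qb b / 4)
        * ((ζ:ℂ) - Complex.I * Qb b / 2 + 2 * ω)) *
      sb b ((x:ℂ) - Complex.I * Qb b / 4 - (ζ:ℂ))
        / sb b ((x:ℂ) - Complex.I * Qb b / 4 + Complex.I * Qb b / 2)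

/-- The exponent `f_𝓜(ζ, ω)`. -/
def fM (ζ : ℝ) (ω : ℂ) : ℂ :=
  -(Li2 (-Complex.exp (2 * (Real.pi:ℂ) * (ζ:ℂ)))
    + Li2 (-(Complex.exp (-((Real.pi:ℂ) * (ζ:ℂ))) * Complex.cosh ((Real.pi:ℂ) * ω)
        / Complex.sinh ((Real.pi:ℂ) * ((ζ:ℂ) + ω))))
    - Li2 (Complex.exp ((Real.pi:ℂ) * (ζ:ℂ)) * Complex.cosh ((Real.pi:ℂ) * ω)
        / Complex.sinh ((Real.pi:ℂ) * ((ζ:ℂ) + ω))))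
    / (2 * (Real.pi:ℂ) * Complex.I)
  + Complex.I * (Real.pi:ℂ) * (ζ:ℂ)^2
  + Complex.I * (ω - Complex.I / 2) *
      Complex.log (Complex.exp ((Real.pi:ℂ) * (ζ:ℂ)) * Complex.cosh ((Real.pi:ℂ) * ω)
        / Complex.sinh ((Real.pi:ℂ) * ((ζ:ℂ) + ω)))
  + Complex.I * (Real.pi:ℂ) / 6

/-- The function `𝓠(b, σ', μ')`, the contour being the horizontal line `Im = -3Q/8`. -/
def Qfun (b : ℝ) (σ μ : ℝ) : ℂ :=
  Complex.exp (Complex.I * (Real.pi:ℂ) *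
      (1/6 + 7 * (Qb b)^2 / 24 - (μ:ℂ)^2/2 + Complex.I * (μ:ℂ) * Qb b - (σ:ℂ)^2)) * sb b μ *
  ∫ x : ℝ,
    Complex.exp (-(Complex.I * (Real.pi:ℂ) * ((x:ℂ) - 3 * Complex.I * Qb b / 8)^2)) *
    Complex.exp (2 * Complex.I * (Real.pi:ℂ) * ((x:ℂ) - 3 * Complex.I * Qb b / 8)
      * ((μ:ℂ) - Complex.I * Qb b / 2)) *
    sb b ((x:ℂ) - 3 * Complex.I * Qb b / 8 + (σ:ℂ)) *
    sb b ((x:ℂ) - 3 * Complex.I * Qb b / 8 - (σ:ℂ))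

/-- The exponent `f_𝓠(σ, μ)`. -/
def fQ (σ μ : ℝ) : ℂ :=
  -(Li2 (-Complex.exp (2 * (Real.pi:ℂ) * (μ:ℂ)))) / (2 * (Real.pi:ℂ) * Complex.I)
  - Li2 (Complex.exp (-(2 * (Real.pi:ℂ) * (σ:ℂ))) *
      ((Real.cosh (2*Real.pi*σ) : ℂ) + Complex.I *
        (Real.sqrt (Real.exp (2*Real.pi*μ) - Real.sinh (2*Real.pi*σ)^2) : ℂ)))
    / (2 * (Real.pi:ℂ) * Complex.I)
  - Li2 (Complex.exp (2 * (Real.pi:ℂ) * (σ:ℂ)) *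
      ((Real.cosh (2*Real.pi*σ) : ℂ) + Complex.I *
        (Real.sqrt (Real.exp (2*Real.pi*μ) - Real.sinh (2*Real.pi*σ)^2) : ℂ)))
    / (2 * (Real.pi:ℂ) * Complex.I)
  + (1/2 + Complex.I * (μ:ℂ)) *
      Complex.log (-(Real.cosh (2*Real.pi*σ) : ℂ) - Complex.I *
        (Real.sqrt (Real.exp (2*Real.pi*μ) - Real.sinh (2*Real.pi*σ)^2) : ℂ))
  - (Real.pi:ℂ) * (μ:ℂ) + 5 * (Real.pi:ℂ) * Complex.I / 12

/-- The phase function `f(t)` of the saddle point analysis of `𝓜`. -/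
def fMt (ζ : ℝ) (ω t : ℂ) : ℂ :=
  -(Li2 (-Complex.exp (2*(Real.pi:ℂ)*(ζ:ℂ)))
    + Li2 (-Complex.exp (2*(Real.pi:ℂ)*(t-(ζ:ℂ))))
    - Li2 (-Complex.exp (2*(Real.pi:ℂ)*(t+Complex.I/2)))) / (2*(Real.pi:ℂ)*Complex.I)
  + Complex.I*(Real.pi:ℂ)*(ζ:ℂ)^2 + 2*Complex.I*(Real.pi:ℂ)*t*ω + (Real.pi:ℂ)*t
  + Complex.I*(Real.pi:ℂ)/6

/-- The amplitude `g(t)` of the saddle point analysis of `𝓜`. -/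
def gM (t : ℂ) : ℂ :=
  Complex.exp ((Real.pi:ℂ)*t - Complex.log (1 - Complex.exp (2*(Real.pi:ℂ)*t)) / 2)

/-- The error term `E(τ, t)` from the semiclassical analysis of `𝓜`. -/
def Efun (ζ τ : ℝ) (t : ℂ) : ℂ :=
  Complex.I * (Li2 (Complex.exp (2*(Real.pi:ℂ)*t))
      - Li2 (Complex.exp (Complex.I*(Real.pi:ℂ)*(τ:ℂ) + 2*(Real.pi:ℂ)*t))) / (2*(Real.pi:ℂ)*(τ:ℂ))
  + Complex.log (1 - Complex.exp (2*(Real.pi:ℂ)*t)) / 2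
  + (Complex.I*(Real.pi:ℂ)*(τ:ℂ)/12) *
      (Complex.exp (2*(Real.pi:ℂ)*t + Complex.I*(Real.pi:ℂ)*(τ:ℂ))
          / (Complex.exp (2*(Real.pi:ℂ)*t + Complex.I*(Real.pi:ℂ)*(τ:ℂ)) - 1)
        - Complex.exp (2*(Real.pi:ℂ)*(ζ:ℂ)) / (Complex.exp (2*(Real.pi:ℂ)*(ζ:ℂ)) + 1)
        - Complex.exp (2*(Real.pi:ℂ)*t)
          / (Complex.exp (2*(Real.pi:ℂ)*(ζ:ℂ)) + Complex.exp (2*(Real.pi:ℂ)*t)) + 2)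

/-- The phase function `f(t)` of the saddle point analysis of `𝓠`. -/
def fQt (σ μ : ℝ) (t : ℂ) : ℂ :=
  -(Li2 (-Complex.exp (2*(Real.pi:ℂ)*(μ:ℂ)))
    + Li2 (-Complex.exp (2*(Real.pi:ℂ)*(t-(σ:ℂ))))
    + Li2 (-Complex.exp (2*(Real.pi:ℂ)*(t+(σ:ℂ))))) / (2*(Real.pi:ℂ)*Complex.I)
  + 2*Complex.I*(Real.pi:ℂ)*(μ:ℂ)*t + (Real.pi:ℂ)*(t-(μ:ℂ)) + 5*Complex.I*(Real.pi:ℂ)/12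

/-- The amplitude `g(t)` of the saddle point analysis of `𝓠`. -/
def gQ (μ : ℝ) (t : ℂ) : ℂ := Complex.exp ((Real.pi:ℂ)*(t-(μ:ℂ)))

end

theorem aux_slit (z : ℂ) (hz : 1 - z ∈ Complex.slitPlane) (t : ℝ) (h0 : 0 ≤ t) (h1 : t ≤ 1) :
    1 - (t:ℂ) * z ∈ Complex.slitPlane := by
  rw [Complex.mem_slitPlane_iff] at *
  rcases eq_or_lt_of_le h0 with h | h
  · left; simp [← h]
  · rcases hz with hz | hz
    · left
      simp at hz ⊢
      nlinarith
    · right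
      simp at hz ⊢
      exact ⟨h.ne', hz⟩

theorem aux_Li2 (z : ℂ) (hz : 1 - z ∈ Complex.slitPlane) (hz0 : z ≠ 0) :
    HasDerivAt Li2 (-(Complex.log (1 - z) / z)) z := by
  have hopen : IsOpen {w : ℂ | 1 - w ∈ Complex.slitPlane} :=
    Complex.isOpen_slitPlane.preimage (by fun_prop)
  obtain ⟨ε, hε, hball⟩ := Metric.nhds_basis_closedBall.mem_iff.1 (hopen.mem_nhds hz)
  have hcont : ContinuousOn (fun p : ℝ × ℂ => -(1 / (1 - (p.1:ℂ) * p.2)))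
      (Set.Icc (0:ℝ) 1 ×ˢ Metric.closedBall z ε) := by
    apply ContinuousOn.neg
    apply ContinuousOn.div continuousOn_const
    · fun_prop
    · rintro ⟨t, w⟩ ⟨ht, hw⟩
      exact Complex.slitPlane_ne_zero (aux_slit w (hball hw) t ht.1 ht.2)
  obtain ⟨C, hC⟩ := (isCompact_Icc.prod (isCompact_closedBall z ε)).exists_bound_of_continuousOn hcont
  have hd : ∀ t ∈ Set.Icc (0:ℝ) 1, HasDerivAt (fun t : ℝ => Complex.log (1 - (t:ℂ) * z))
      (-z / (1 - (t:ℂ) * z)) t := by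
    intro t ht
    have h1 : HasDerivAt (fun s : ℂ => 1 - s * z) (-z) (t:ℂ) := by
      simpa using ((hasDerivAt_id (t:ℂ)).mul_const z).const_sub 1
    exact (h1.clog (aux_slit z hz t ht.1 ht.2)).comp_ofReal
  have hFint : IntervalIntegrable (fun t : ℝ => Complex.log (1 - (t:ℂ) * z) / (t:ℂ)) volume 0 1 := by
    have hc : ContinuousOn (dslope (fun t : ℝ => Complex.log (1 - (t:ℂ) * z)) 0) (Set.Icc 0 1) := by
      intro t ht
      apply ContinuousAt.continuousWithinAt
      rcases eq_or_ne t 0 with h | h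
      · subst h
        exact continuousAt_dslope_same.2 (hd 0 ht).differentiableAt
      · exact (continuousAt_dslope_of_ne h).2 (hd t ht).continuousAt
    have hi := hc.intervalIntegrable_of_Icc (μ := volume) zero_le_one
    refine hi.congr ?_
    intro t ht
    rw [Set.uIoc_of_le zero_le_one] at ht
    simp only
    rw [dslope_of_ne _ ht.1.ne', slope_def_module]
    simp [div_eq_inv_mul]
  have key := intervalIntegral.hasDerivAt_integral_of_dominated_loc_of_deriv_le
    (μ := volume) (a := 0) (b := 1) (x₀ := z) (s := Metric.ball z ε) (bound := fun _ => C)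
    (F := fun w (t:ℝ) => Complex.log (1 - (t:ℂ) * w) / (t:ℂ))
    (F' := fun w (t:ℝ) => -(1 / (1 - (t:ℂ) * w)))
    (Metric.ball_mem_nhds z hε)
    (Filter.Eventually.of_forall fun w => by
      apply Measurable.aestronglyMeasurable
      exact (Complex.measurable_log.comp (by fun_prop)).div (by fun_prop))
    hFint
    (by
      apply Measurable.aestronglyMeasurable
      fun_prop)
    (Filter.Eventually.of_forall fun t ht w hw => by
      rw [Set.uIoc_of_le zero_le_one] at ht
      exact hC (t, w) ⟨⟨ht.1.le, ht.2⟩, Metric.ball_subset_closedBall hw⟩)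
    (by simp)
    (Filter.Eventually.of_forall fun t ht w hw => by
      rw [Set.uIoc_of_le zero_le_one] at ht
      have h1 : HasDerivAt (fun s : ℂ => 1 - (t:ℂ) * s) (-(t:ℂ)) w := by
        simpa using ((hasDerivAt_id w).const_mul (t:ℂ)).const_sub 1
      have hs := aux_slit w (hball (Metric.ball_subset_closedBall hw)) t ht.1.le ht.2
      have h2 := (h1.clog hs).div_const (t:ℂ)
      refine HasDerivAt.congr_deriv (h2) ?_
      have : (t:ℂ) ≠ 0 := by exact_mod_cast ht.1.ne'
      have := Complex.slitPlane_ne_zero hs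
      field_simp)
  have hftc : ∫ t in (0:ℝ)..1, -(1 / (1 - (t:ℂ) * z)) = Complex.log (1 - z) / z := by
    have := intervalIntegral.integral_eq_sub_of_hasDerivAt (a := 0) (b := 1)
      (f := fun t : ℝ => Complex.log (1 - (t:ℂ) * z) / z)
      (f' := fun t : ℝ => -(1 / (1 - (t:ℂ) * z))) (by
        intro t ht
        rw [Set.uIcc_of_le zero_le_one] at ht
        refine HasDerivAt.congr_deriv ((hd t ht).div_const z) ?_
        have := Complex.slitPlane_ne_zero (aux_slit z hz t ht.1 ht.2)
        field_simp) key.1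
    rw [this]; simp
  have k2 := key.2.neg
  rw [hftc] at k2
  exact k2

theorem aux_log {w y : ℂ} (h : w = Complex.exp y) (h1 : -Real.pi < y.im) (h2 : y.im ≤ Real.pi) :
    Complex.log w = y := by rw [h, Complex.log_exp h1 h2]

theorem aux_arg_pos {z : ℂ} (h : 0 < z.im) : 0 < z.arg ∧ z.arg < Real.pi := by
  constructor
  · rcases (Complex.arg_nonneg_iff.2 h.le).lt_or_eq with h' | h'
    · exact h'
    · exact absurd (Complex.arg_eq_zero_iff.1 h'.symm).2 h.ne'
  · rw [Complex.arg_lt_pi_iff]; right; exact h.ne'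

theorem aux_arg_neg {z : ℂ} (h : z.im < 0) : z.arg < 0 := Complex.arg_neg_iff.2 h

theorem aux_im (u : ℝ) (v A : ℂ) (hu : 0 < u) (hv : 0 < v.im)
    (hA : A = u * (v + 1) / (u * v - 1)) : A.im < 0 := by
  have hne : (u * v - 1 : ℂ) ≠ 0 := by
    intro h
    have := congrArg Complex.im h
    simp at this
    rcases this with h | h <;> linarith
  have : A = 1 + ((1 + u : ℝ) : ℂ) * (u * v - 1)⁻¹ := by
    rw [hA]; push_cast; field_simp; ring
  rw [this]
  have hn := Complex.normSq_pos.2 hne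
  simp only [Complex.add_im, Complex.one_im, Complex.im_ofReal_mul, Complex.inv_im]
  simp
  apply mul_neg_of_pos_of_neg (by linarith)
  apply div_neg_of_neg_of_pos _ hn
  nlinarith

/-- the partial differential equations satisfied by `f_𝓜`. -/
theorem fM_partial_derivatives (ζ : ℝ) (ω : ℂ) (hω1 : 0 < ω.im) (hω2 : ω.im < 1/2) :
    HasDerivAt (fun x : ℝ => fM x ω)
      (2*Complex.I*(Real.pi:ℂ)*((ζ:ℂ)+ω) + (Real.pi:ℂ)
        - Complex.I * Complex.log (1 - Complex.exp (2*(Real.pi:ℂ)*((ζ:ℂ)+ω)))) ζ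
    ∧ HasDerivAt (fun w : ℂ => fM ζ w)
      ((Real.pi:ℂ) + 2*Complex.I*(Real.pi:ℂ)*(ζ:ℂ)
        - Complex.I * Complex.log ((1 - Complex.exp (2*(Real.pi:ℂ)*((ζ:ℂ)+ω)))
            / (1 + Complex.exp (2*(Real.pi:ℂ)*ω)))) ω := by
  have hpi := Real.pi_pos
  have hpiC : (Real.pi:ℂ) ≠ 0 := by exact_mod_cast hpi.ne'
  obtain ⟨p, hp⟩ : ∃ p, p = Complex.exp ((Real.pi:ℂ) * ζ) := ⟨_, rfl⟩
  obtain ⟨q, hq⟩ : ∃ q, q = Complex.exp ((Real.pi:ℂ) * ω) := ⟨_, rfl⟩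
  obtain ⟨u, hu⟩ : ∃ u, u = Real.exp (2 * Real.pi * ζ) := ⟨_, rfl⟩
  obtain ⟨v, hv⟩ : ∃ v, v = Complex.exp (2 * (Real.pi:ℂ) * ω) := ⟨_, rfl⟩
  have hp0 : p ≠ 0 := hp ▸ Complex.exp_ne_zero _
  have hq0 : q ≠ 0 := hq ▸ Complex.exp_ne_zero _
  have hv0 : v ≠ 0 := hv ▸ Complex.exp_ne_zero _
  have hu0 : 0 < u := hu ▸ Real.exp_pos _
  have huC : (u:ℂ) = Complex.exp (2 * (Real.pi:ℂ) * ζ) := by rw [hu]; push_cast; rfl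
  have hup : (u:ℂ) = p ^ 2 := by rw [huC, hp, ← Complex.exp_nat_mul]; congr 1; push_cast; ring
  have hvq : v = q ^ 2 := by rw [hv, hq, ← Complex.exp_nat_mul]; congr 1; push_cast; ring
  have hu0C : (u:ℂ) ≠ 0 := by exact_mod_cast hu0.ne'
  have hvim : 0 < v.im := by
    rw [hv, Complex.exp_im]
    apply mul_pos (Real.exp_pos _)
    apply Real.sin_pos_of_pos_of_lt_pi
    · simp; positivity
    · simp; nlinarith
  have hne : (u * v - 1 : ℂ) ≠ 0 := by
    intro h
    have := congrArg Complex.im h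
    simp at this
    rcases this with h | h <;> linarith
  have hv1 : (v + 1 : ℂ) ≠ 0 := by
    intro h
    have := congrArg Complex.im h
    simp at this
    linarith
  have huv : Complex.exp (2*(Real.pi:ℂ)*((ζ:ℂ)+ω)) = u * v := by
    rw [huC, hv, ← Complex.exp_add]; congr 1; ring
  have hsum : Complex.exp ((Real.pi:ℂ)*((ζ:ℂ)+ω)) = p * q := by
    rw [hp, hq, ← Complex.exp_add]; congr 1; ring
  have hS : Complex.sinh ((Real.pi:ℂ)*((ζ:ℂ)+ω)) = (u * v - 1) / (2 * p * q) := by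
    rw [Complex.sinh, Complex.exp_neg, hsum, hup, hvq]; field_simp
  have hCh : Complex.cosh ((Real.pi:ℂ)*ω) = (v + 1) / (2 * q) := by
    rw [Complex.cosh, Complex.exp_neg, ← hq, hvq]; field_simp
  have hS0 : Complex.sinh ((Real.pi:ℂ)*((ζ:ℂ)+ω)) ≠ 0 := by rw [hS]; exact div_ne_zero hne (by simp [hp0, hq0])
  have hCh0 : Complex.cosh ((Real.pi:ℂ)*ω) ≠ 0 := by rw [hCh]; exact div_ne_zero hv1 (by simp [hq0])
  obtain ⟨A, hA⟩ : ∃ A, A = Complex.exp ((Real.pi:ℂ) * (ζ:ℂ)) * Complex.cosh ((Real.pi:ℂ) * ω)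
        / Complex.sinh ((Real.pi:ℂ) * ((ζ:ℂ) + ω)) := ⟨_, rfl⟩
  obtain ⟨B, hB⟩ : ∃ B, B = Complex.exp (-((Real.pi:ℂ) * (ζ:ℂ))) * Complex.cosh ((Real.pi:ℂ) * ω)
        / Complex.sinh ((Real.pi:ℂ) * ((ζ:ℂ) + ω)) := ⟨_, rfl⟩
  have hA' : A = u * (v + 1) / (u * v - 1) := by
    rw [hA, hS, hCh, ← hp]; field_simp; rw [hup]
  have hB' : B = (v + 1) / (u * v - 1) := by
    rw [hB, hS, hCh, Complex.exp_neg, ← hp]; field_simp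
  have hAB : A = u * B := by rw [hA', hB']; ring
  have hAim : A.im < 0 := aux_im u v A hu0 hvim hA'
  have hBim : B.im < 0 := by
    rw [hAB, Complex.im_ofReal_mul] at hAim
    by_contra h
    push Not at h
    have := mul_nonneg hu0.le h
    linarith
  have hA0 : A ≠ 0 := by rintro rfl; simp at hAim
  have hB0 : B ≠ 0 := by rintro rfl; simp at hBim
  have hAs : A ∈ Complex.slitPlane := Complex.mem_slitPlane_iff.2 (Or.inr hAim.ne)
  have h1As : 1 - A ∈ Complex.slitPlane :=
    Complex.mem_slitPlane_iff.2 (Or.inr (by simpa using hAim.ne))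
  have h1Bs : 1 - -B ∈ Complex.slitPlane :=
    Complex.mem_slitPlane_iff.2 (Or.inr (by simpa using hBim.ne))
  have h1us : 1 - -(u:ℂ) ∈ Complex.slitPlane :=
    Complex.mem_slitPlane_iff.2 (Or.inl (by simp; linarith))
  have h1A0 := Complex.slitPlane_ne_zero h1As
  obtain ⟨ha1, ha2⟩ := aux_arg_pos (z := 1 - A) (by simpa using hAim)
  have ha3 := aux_arg_neg hAim
  have ha4 := Complex.neg_pi_lt_arg A
  have hvi1 : (2 * (Real.pi:ℂ) * ω).im = 2 * Real.pi * ω.im := by simp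
  have hu1 : (1 + u : ℂ) ≠ 0 := by
    have : (1 + u : ℝ) ≠ 0 := by linarith
    exact_mod_cast this
  have hne' : (1 - u * v : ℂ) ≠ 0 := by
    rw [← neg_sub]; exact neg_ne_zero.2 hne
  have h1A : 1 - A = (1 + u) / (1 - u * v) := by
    rw [hA', eq_div_iff hne', sub_mul, div_mul_eq_mul_div, ← neg_sub (u * v : ℂ) 1]
    field_simp
    ring
  have L1 : Complex.log (1 - -B) = Complex.log (1 - A) + 2 * Real.pi * ω - Real.pi * Complex.I := by
    apply aux_log
    · rw [Complex.exp_sub, Complex.exp_add, Complex.exp_log h1A0, Complex.exp_pi_mul_I, ← hv,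
        h1A, hB', ← neg_sub (u * v : ℂ) 1, div_neg (1 + (u:ℂ)), sub_neg_eq_add]
      have e : 1 + (v + 1) / (u * v - 1 : ℂ) = v * (1 + u) / (u * v - 1) := by
        rw [eq_div_iff hne, add_mul, div_mul_cancel₀ _ hne]; ring
      rw [e]
      generalize (u * v - 1 : ℂ) = d
      ring
    · simp only [Complex.sub_im, Complex.add_im, hvi1, Complex.log_im]
      simp
      nlinarith
    · simp only [Complex.sub_im, Complex.add_im, hvi1, Complex.log_im]
      simp
      nlinarith
  have L2 : Complex.log ((1 - u * v) / (1 + v)) =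
      2 * Real.pi * ζ - Complex.log A - Real.pi * Complex.I := by
    have hv1' : (1 + v : ℂ) ≠ 0 := by rwa [add_comm]
    apply aux_log
    · rw [Complex.exp_sub, Complex.exp_sub, Complex.exp_log hA0, Complex.exp_pi_mul_I, ← huC, hA']
      field_simp
      ring
    · simp [Complex.log_im]; linarith
    · simp [Complex.log_im]; linarith
  have L3 : Complex.log (1 - u * v) = Complex.log (1 - -(u:ℂ)) - Complex.log (1 - A) := by
    have hr : (Complex.log (1 - -(u:ℂ))).im = 0 := by
      rw [Complex.log_im, Complex.arg_eq_zero_iff]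
      simp; linarith
    apply aux_log
    · rw [Complex.exp_sub, Complex.exp_log h1A0, Complex.exp_log (Complex.slitPlane_ne_zero h1us),
        h1A, sub_neg_eq_add]
      field_simp
    · rw [Complex.sub_im, hr, Complex.log_im]; linarith
    · rw [Complex.sub_im, hr, Complex.log_im]; linarith
  have dLA := aux_Li2 A h1As hA0
  have dLB := aux_Li2 (-B) h1Bs (neg_ne_zero.2 hB0)
  have dLu := aux_Li2 (-(u:ℂ)) h1us (neg_ne_zero.2 hu0C)
  rw [huv]
  constructor
  · obtain ⟨M, hM⟩ : ∃ M, M = (Real.pi:ℂ) * Complex.cosh ((Real.pi:ℂ)*((ζ:ℂ)+ω)) /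
      Complex.sinh ((Real.pi:ℂ)*((ζ:ℂ)+ω)) := ⟨_, rfl⟩
    have dS : HasDerivAt (fun x : ℂ => Complex.sinh ((Real.pi:ℂ) * (x + ω)))
        (Complex.cosh ((Real.pi:ℂ)*((ζ:ℂ)+ω)) * Real.pi) (ζ:ℂ) := by
      simpa using (((hasDerivAt_id (ζ:ℂ)).add_const ω).const_mul (Real.pi:ℂ)).csinh
    have dE : HasDerivAt (fun x : ℂ => Complex.exp ((Real.pi:ℂ) * x))
        (Complex.exp ((Real.pi:ℂ)*ζ) * Real.pi) (ζ:ℂ) := by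
      simpa using ((hasDerivAt_id (ζ:ℂ)).const_mul (Real.pi:ℂ)).cexp
    have dE' : HasDerivAt (fun x : ℂ => Complex.exp (-((Real.pi:ℂ) * x)))
        (Complex.exp (-((Real.pi:ℂ)*ζ)) * (-Real.pi)) (ζ:ℂ) := by
      simpa using ((hasDerivAt_id (ζ:ℂ)).const_mul (Real.pi:ℂ)).neg.cexp
    have dU : HasDerivAt (fun x : ℂ => -Complex.exp (2 * (Real.pi:ℂ) * x))
        (-(u * (2 * Real.pi))) (ζ:ℂ) := by
      rw [huC]
      have h : HasDerivAt (fun x : ℂ => Complex.exp (2 * (Real.pi:ℂ) * x))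
        (Complex.exp (2 * (Real.pi:ℂ) * ζ) * (2 * Real.pi)) (ζ:ℂ) := by
        simpa using ((hasDerivAt_id (ζ:ℂ)).const_mul (2 * (Real.pi:ℂ))).cexp
      exact h.neg
    have dA : HasDerivAt (fun x : ℂ => Complex.exp ((Real.pi:ℂ) * x) * Complex.cosh ((Real.pi:ℂ) * ω)
        / Complex.sinh ((Real.pi:ℂ) * (x + ω))) (A * (Real.pi - M)) (ζ:ℂ) := by
      refine HasDerivAt.congr_deriv ((dE.mul_const (Complex.cosh ((Real.pi:ℂ) * ω))).div dS hS0) ?_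
      rw [hA, hM]; field_simp
    have dB : HasDerivAt (fun x : ℂ => -(Complex.exp (-((Real.pi:ℂ) * x)) * Complex.cosh ((Real.pi:ℂ) * ω)
        / Complex.sinh ((Real.pi:ℂ) * (x + ω)))) (-(B * (-Real.pi - M))) (ζ:ℂ) := by
      refine HasDerivAt.congr_deriv (((dE'.mul_const (Complex.cosh ((Real.pi:ℂ) * ω))).div dS hS0).neg) ?_
      rw [hB, hM]; field_simp
    rw [hA] at dLA hAs
    rw [hB] at dLB
    rw [huC] at dLu
    have c1 := HasDerivAt.comp (ζ:ℂ) dLu dU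
    have c2 := HasDerivAt.comp (ζ:ℂ) dLB dB
    have c3 := HasDerivAt.comp (ζ:ℂ) dLA dA
    have c4 := dA.clog hAs
    rw [← hA] at c3 c4
    rw [← hB] at c2
    rw [← huC] at c1
    have c5 : HasDerivAt (fun x : ℂ => Complex.I * (Real.pi:ℂ) * x ^ 2)
      (Complex.I * (Real.pi:ℂ) * (2 * ζ)) (ζ:ℂ) := by
      simpa using ((hasDerivAt_id (ζ:ℂ)).pow 2).const_mul (Complex.I * (Real.pi:ℂ))
    have tot := (((((c1.add c2).sub c3).neg.div_const (2 * (Real.pi:ℂ) * Complex.I)).add c5).add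
      (c4.const_mul (Complex.I * (ω - Complex.I / 2)))).add_const (Complex.I * (Real.pi:ℂ) / 6)
    have tot' := tot.comp_ofReal
    refine HasDerivAt.congr_deriv (f := fun x : ℝ => fM x ω) tot' ?_
    rw [L1, L3]
    generalize Complex.log (1 - -(u:ℂ)) = l1
    generalize Complex.log (1 - A) = l2
    have hI := Complex.I_sq
    have hI0 := Complex.I_ne_zero
    field_simp
    ring_nf
    simp only [Complex.I_sq, Complex.I_pow_three]
    ring
  · obtain ⟨M, hM⟩ : ∃ M, M = (Real.pi:ℂ) * Complex.sinh ((Real.pi:ℂ)*ω) /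
      Complex.cosh ((Real.pi:ℂ)*ω) - (Real.pi:ℂ) * Complex.cosh ((Real.pi:ℂ)*((ζ:ℂ)+ω)) /
      Complex.sinh ((Real.pi:ℂ)*((ζ:ℂ)+ω)) := ⟨_, rfl⟩
    have dS : HasDerivAt (fun x : ℂ => Complex.sinh ((Real.pi:ℂ) * (ζ + x)))
        (Complex.cosh ((Real.pi:ℂ)*((ζ:ℂ)+ω)) * Real.pi) ω := by
      simpa using (((hasDerivAt_id ω).const_add (ζ:ℂ)).const_mul (Real.pi:ℂ)).csinh
    have dC : HasDerivAt (fun x : ℂ => Complex.cosh ((Real.pi:ℂ) * x))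
        (Complex.sinh ((Real.pi:ℂ)*ω) * Real.pi) ω := by
      simpa using ((hasDerivAt_id ω).const_mul (Real.pi:ℂ)).ccosh
    have dA : HasDerivAt (fun x : ℂ => Complex.exp ((Real.pi:ℂ) * ζ) * Complex.cosh ((Real.pi:ℂ) * x)
        / Complex.sinh ((Real.pi:ℂ) * (ζ + x))) (A * M) ω := by
      refine HasDerivAt.congr_deriv ((dC.const_mul (Complex.exp ((Real.pi:ℂ) * ζ))).div dS hS0) ?_
      rw [hA, hM]; field_simp
    have dB : HasDerivAt (fun x : ℂ => -(Complex.exp (-((Real.pi:ℂ) * ζ)) * Complex.cosh ((Real.pi:ℂ) * x)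
        / Complex.sinh ((Real.pi:ℂ) * (ζ + x)))) (-(B * M)) ω := by
      refine HasDerivAt.congr_deriv (((dC.const_mul (Complex.exp (-((Real.pi:ℂ) * ζ)))).div dS hS0).neg) ?_
      rw [hB, hM]; field_simp
    rw [hA] at dLA hAs
    rw [hB] at dLB
    have c2 := HasDerivAt.comp ω dLB dB
    have c3 := HasDerivAt.comp ω dLA dA
    have c4 := dA.clog hAs
    rw [← hA] at c3 c4
    rw [← hB] at c2
    have c5 : HasDerivAt (fun x : ℂ => Complex.I * (x - Complex.I / 2)) Complex.I ω := by
      simpa using ((hasDerivAt_id ω).sub_const (Complex.I / 2)).const_mul Complex.I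
    have tot := (((((c2.const_add (Li2 (-Complex.exp (2 * (Real.pi:ℂ) * (ζ:ℂ))))).sub
      c3).neg.div_const (2 * (Real.pi:ℂ) * Complex.I)).add_const
      (Complex.I * (Real.pi:ℂ) * (ζ:ℂ)^2)).add (c5.mul c4)).add_const (Complex.I * (Real.pi:ℂ) / 6)
    refine HasDerivAt.congr_deriv (f := fun x : ℂ => fM ζ x) tot ?_
    rw [← hA, ← hv, L1, L2]
    generalize Complex.log A = l1
    generalize Complex.log (1 - A) = l2
    have hI0 := Complex.I_ne_zero
    field_simp
    ring_nf
    simp only [Complex.I_sq, Complex.I_pow_three]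
    ring
end

section
/- Let σ, μ ∈ ℝ satisfy e^{2πμ} > sinh²(2πσ). Then there exist constants C > 0 and b₀ ∈ (0,1) such that for all b ∈ (0, b₀): |𝓠(b, σ/b, μ/b) · e^{−f_𝓠(σ,μ)/b²} − e^{πi/4}/(√2 · (e^{2πμ} − sinh²(2πσ))^{1/4})| ≤ C·b, where (e^{2πμ} − sinh²(2πσ))^{1/4} is the positive real fourth root. (Equivalently, 𝓠(b, σ/b, μ/b) = e^{πi/4}/(√2 (e^{2πμ}−sinh²(2πσ))^{1/4}) · e^{f_𝓠(σ,μ)/b²} (1 + O(b)) as b → 0⁺.) -/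
open MeasureTheory

section
open MeasureTheory Set Filter Topology
set_option linter.unusedSimpArgs false


theorem aux_norm_cos_le (z : ℂ) : ‖Complex.cos z‖ ≤ Real.exp |z.im| := by
  rw [Complex.cos, norm_div]
  have h1 : ‖Complex.exp (z * Complex.I)‖ ≤ Real.exp |z.im| := by
    rw [Complex.norm_exp]; apply Real.exp_le_exp.2; simp [neg_le_abs]
  have h2 : ‖Complex.exp (-z * Complex.I)‖ ≤ Real.exp |z.im| := by
    rw [Complex.norm_exp]; apply Real.exp_le_exp.2; simp [le_abs_self]
  have := norm_add_le (Complex.exp (z * Complex.I)) (Complex.exp (-z * Complex.I))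
  simp only [Complex.norm_ofNat]
  linarith

theorem aux_seg (f f' : ℂ → ℂ) (hf : ∀ z, HasDerivAt f (f' z) z) (z : ℂ) (C : ℝ)
    (hC : ∀ w : ℂ, ‖w‖ ≤ ‖z‖ → |w.im| ≤ |z.im| → ‖f' w‖ ≤ C) : ‖f z - f 0‖ ≤ C * ‖z‖ := by
  have h := Convex.norm_image_sub_le_of_norm_hasDerivWithin_le (f := f) (f' := f') (C := C)
    (s := segment ℝ (0:ℂ) z) (x := 0) (y := z) (fun x _ => (hf x).hasDerivWithinAt) ?_
    (convex_segment _ _) (left_mem_segment _ _ _) (right_mem_segment _ _ _)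
  · simpa using h
  · intro w hw
    obtain ⟨θ, hθ, rfl⟩ := (segment_eq_image' ℝ (0:ℂ) z ▸ hw : _)
    apply hC
    · simp only [sub_zero, zero_add, norm_smul, Real.norm_eq_abs, abs_of_nonneg hθ.1]
      nlinarith [norm_nonneg z, hθ.2]
    · simp only [sub_zero, zero_add, Complex.smul_im, smul_eq_mul, abs_mul, abs_of_nonneg hθ.1]
      nlinarith [abs_nonneg z.im, hθ.2]

theorem aux_norm_sin_le (z : ℂ) : ‖Complex.sin z‖ ≤ Real.exp |z.im| * ‖z‖ := by
  have := aux_seg Complex.sin Complex.cos Complex.hasDerivAt_sin z (Real.exp |z.im|) 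
    (fun w _ hw => (aux_norm_cos_le w).trans (Real.exp_le_exp.2 hw))
  simpa using this

theorem aux_norm_cos_sub_le (z : ℂ) : ‖Complex.cos z - 1‖ ≤ Real.exp |z.im| * ‖z‖ ^ 2 := by
  have := aux_seg Complex.cos (fun w => -Complex.sin w) Complex.hasDerivAt_cos z
    (Real.exp |z.im| * ‖z‖) (fun w h1 hw => by
      rw [norm_neg]
      refine (aux_norm_sin_le w).trans ?_
      gcongr)
  rw [Complex.cos_zero] at this
  nlinarith

theorem aux_norm_sin_sub_le (z : ℂ) : ‖Complex.sin z - z‖ ≤ Real.exp |z.im| * ‖z‖ ^ 3 := by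
  have := aux_seg (fun w => Complex.sin w - w) (fun w => Complex.cos w - 1)
    (fun w => (Complex.hasDerivAt_sin w).sub (hasDerivAt_id w)) z
    (Real.exp |z.im| * ‖z‖ ^ 2) (fun w h1 hw => by
      refine (aux_norm_cos_sub_le w).trans ?_
      gcongr)
  simp only [Complex.sin_zero, sub_zero] at this
  nlinarith

theorem aux_div_sinh_le {u : ℝ} (hu : 0 < u) :
    u / Real.sinh u ≤ (1 + 2 * u) * Real.exp (-u) := by
  have hs : 0 < Real.sinh u := Real.sinh_pos_iff.2 hu
  rw [div_le_iff₀ hs, Real.sinh_eq]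
  have h1 : Real.exp (-u) * Real.exp u = 1 := by rw [← Real.exp_add]; simp
  have h2 : (1 + 2 * u) * (Real.exp (-u) * Real.exp (-u)) ≤ 1 := by
    rw [← Real.exp_add]
    have : 1 + 2 * u ≤ Real.exp (2*u) := by linarith [Real.add_one_le_exp (2*u)]
    calc (1 + 2 * u) * Real.exp (-u + -u) ≤ Real.exp (2*u) * Real.exp (-u + -u) := by gcongr
      _ = 1 := by rw [← Real.exp_add]; ring_nf; simp
  nlinarith

/-- dominating weight -/
noncomputable def Bd (u v : ℝ) : ℝ := u / Real.sinh u * Real.exp (2 * u * v)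

theorem Bd_nonneg {u : ℝ} (hu : 0 < u) (v : ℝ) : 0 ≤ Bd u v := by
  have hs : 0 < Real.sinh u := Real.sinh_pos_iff.2 hu
  unfold Bd; positivity

theorem Bd_mono {u : ℝ} (hu : 0 < u) {v w : ℝ} (h : v ≤ w) : Bd u v ≤ Bd u w := by
  have hs : 0 < Real.sinh u := Real.sinh_pos_iff.2 hu
  unfold Bd; gcongr

theorem Bd_integrable {v : ℝ} (hv : v < 1/2) : IntegrableOn (fun u => Bd u v) (Ioi 0) := by
  set c := 1 - 2 * v with hc
  have hc0 : 0 < c := by linarith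
  have h1 : IntegrableOn (fun u => (1 + 4 / c) * Real.exp (-(c/2) * u)) (Ioi 0) :=
    (exp_neg_integrableOn_Ioi 0 (by positivity)).const_mul _
  refine Integrable.mono' h1 ?_ ?_
  · refine ContinuousOn.aestronglyMeasurable ?_ measurableSet_Ioi
    unfold Bd
    refine ContinuousOn.mul (ContinuousOn.div continuousOn_id Real.continuous_sinh.continuousOn ?_)
      (by fun_prop)
    intro x hx; exact (Real.sinh_pos_iff.2 hx).ne'
  · refine (ae_restrict_iff' measurableSet_Ioi).2 (Eventually.of_forall fun u hu => ?_)
    have hu : 0 < u := hu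
    rw [Real.norm_of_nonneg (Bd_nonneg hu v)]
    have e1 : Real.exp (-u) * Real.exp (2 * u * v) = Real.exp (-(c/2)*u) * Real.exp (-(c/2)*u) := by
      rw [← Real.exp_add, ← Real.exp_add]; congr 1; rw [hc]; ring
    have e2 : (1 + 2*u) * Real.exp (-(c/2)*u) ≤ 1 + 4/c := by
      have h3 : c/2*u ≤ Real.exp (c/2*u) := by linarith [Real.add_one_le_exp (c/2*u)]
      have h4 : 2 * u ≤ 4/c * Real.exp (c/2*u) := by
        calc 2 * u = 4/c * (c/2*u) := by field_simp; ring
          _ ≤ _ := by gcongr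
      have h5 : 1 ≤ Real.exp (c/2*u) := Real.one_le_exp (by positivity)
      calc (1 + 2*u) * Real.exp (-(c/2)*u) ≤ ((1 + 4/c) * Real.exp (c/2*u)) * Real.exp (-(c/2)*u) := by
            gcongr; linarith
        _ = 1 + 4/c := by
          rw [mul_assoc, ← Real.exp_add, show c/2*u + -(c/2)*u = 0 by ring]; simp
    calc Bd u v ≤ (1 + 2 * u) * Real.exp (-u) * Real.exp (2 * u * v) := by
          unfold Bd; gcongr; exact aux_div_sinh_le hu
      _ = ((1 + 2*u) * Real.exp (-(c/2)*u)) * Real.exp (-(c/2)*u) := by rw [mul_assoc, e1]; ring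
      _ ≤ _ := by gcongr

/-- the open strip -/
def St : Set ℂ := {t | |t.im| < 1/2}

theorem St_open : IsOpen St := isOpen_lt (by fun_prop) (by fun_prop)

theorem St_convex : Convex ℝ St := by
  have : St = Complex.im ⁻¹' (Ioo (-(1/2)) (1/2)) := by
    ext t; simp [St, abs_lt]
  rw [this]
  exact (convex_Ioo _ _).linear_preimage Complex.imLm

theorem integ_of_bd (f : ℂ → ℝ → ℂ) (A : ℝ) (t : ℂ) (ht : t ∈ St)
    (hc : ContinuousOn (f t) (Ioi 0))
    (hb : ∀ u, 0 < u → ‖f t u‖ ≤ A * (1 + ‖t‖)^3 * Bd u |t.im|) :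
    IntegrableOn (f t) (Ioi 0) := by
  refine Integrable.mono' ((Bd_integrable (v := |t.im|) ht).const_mul (A * (1 + ‖t‖)^3))
    (hc.aestronglyMeasurable measurableSet_Ioi) ?_
  exact (ae_restrict_iff' measurableSet_Ioi).2 (Eventually.of_forall fun u hu => hb u hu)

theorem diff_int (f f' : ℂ → ℝ → ℂ) (A : ℝ) (hA : 0 ≤ A)
    (hd : ∀ t u, 0 < u → HasDerivAt (fun t => f t u) (f' t u) t)
    (hc : ∀ t, ContinuousOn (f t) (Ioi 0)) (hc' : ∀ t, ContinuousOn (f' t) (Ioi 0))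
    (hb : ∀ t u, 0 < u → ‖f t u‖ ≤ A * (1 + ‖t‖)^3 * Bd u |t.im|)
    (hb' : ∀ t u, 0 < u → ‖f' t u‖ ≤ A * (1 + ‖t‖)^3 * Bd u |t.im|)
    (t : ℂ) (ht : t ∈ St) :
    HasDerivAt (fun t => ∫ u in Ioi (0:ℝ), f t u) (∫ u in Ioi (0:ℝ), f' t u) t := by
  have ht' : |t.im| < 1/2 := ht
  obtain ⟨v, hv1, hv2⟩ := exists_between ht'
  let s : Set ℂ := {w | |w.im| < v ∧ ‖w‖ < ‖t‖ + 1}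
  have hs : s ∈ 𝓝 t := by
    refine IsOpen.mem_nhds ?_ ⟨hv1, by simp⟩
    have o1 : IsOpen {w : ℂ | |w.im| < v} := isOpen_lt (by fun_prop) (by fun_prop)
    have o2 : IsOpen {w : ℂ | ‖w‖ < ‖t‖ + 1} := isOpen_lt (by fun_prop) (by fun_prop)
    exact o1.inter o2
  refine (hasDerivAt_integral_of_dominated_loc_of_deriv_le (F := f) (F' := f')
    (bound := fun u => A * (2 + ‖t‖)^3 * Bd u v) hs ?_ ?_ ?_ ?_ ?_ ?_).2
  · exact Eventually.of_forall fun w => (hc w).aestronglyMeasurable measurableSet_Ioi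
  · exact integ_of_bd f A t ht (hc t) (hb t)
  · exact (hc' t).aestronglyMeasurable measurableSet_Ioi
  · refine (ae_restrict_iff' measurableSet_Ioi).2 (Eventually.of_forall fun u hu w hw => ?_)
    have hu : 0 < u := hu
    refine (hb' w u hu).trans ?_
    have := Bd_nonneg hu |w.im|
    have h2 := Bd_mono hu hw.1.le
    have h3 : 1 + ‖w‖ ≤ 2 + ‖t‖ := by linarith [hw.2]
    gcongr
  · exact (Bd_integrable hv2).const_mul _
  · exact (ae_restrict_iff' measurableSet_Ioi).2 (Eventually.of_forall fun u hu w _ => hd w u hu)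

theorem aux_sinh_le {x : ℝ} (hx : 0 ≤ x) : Real.sinh x ≤ x * Real.cosh x := by
  have h : MonotoneOn (fun x : ℝ => x * Real.cosh x - Real.sinh x) (Ici 0) := by
    refine monotoneOn_of_hasDerivWithinAt_nonneg (f' := fun x => x * Real.sinh x) (convex_Ici 0)
      (by fun_prop) ?_ ?_
    · intro x hx
      have := (((hasDerivAt_id x).mul (Real.hasDerivAt_cosh x)).sub (Real.hasDerivAt_sinh x))
      refine (this.congr_deriv ?_).hasDerivWithinAt
      simp
    · intro x hx
      rw [interior_Ici] at hx
      have := Real.sinh_pos_iff.2 hx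
      have hx : 0 < x := hx
      positivity
  have := h (mem_Ici.2 le_rfl) (mem_Ici.2 hx) hx
  simp at this
  linarith

theorem aux_one_sub {x : ℝ} (hx : 0 < x) :
    |x / Real.sinh x - 1| ≤ x^2 / 2 ∧ |x / Real.sinh x - 1| ≤ 1 := by
  have hs : 0 < Real.sinh x := Real.sinh_pos_iff.2 hx
  have hc : 0 < Real.cosh x := Real.cosh_pos x
  have h1 : x / Real.sinh x ≤ 1 := by
    rw [div_le_one hs]; exact (Real.self_le_sinh_iff.2 hx.le)
  have h2 : 1 - x^2/2 ≤ x / Real.sinh x := by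
    calc 1 - x^2/2 ≤ Real.exp (-(x^2/2)) := by linarith [Real.add_one_le_exp (-(x^2/2))]
      _ = 1 / Real.exp (x^2/2) := by rw [Real.exp_neg, one_div]
      _ ≤ 1 / Real.cosh x := by gcongr; exact Real.cosh_le_exp_half_sq x
      _ ≤ x / Real.sinh x := by
        rw [div_le_div_iff₀ hc hs]; linarith [aux_sinh_le hx.le]
  have h3 : 0 < x / Real.sinh x := by positivity
  constructor <;> rw [abs_le] <;> constructor <;> nlinarith


noncomputable def p0 (t : ℂ) (u : ℝ) : ℂ :=
  (Complex.sin (2 * (u:ℂ) * t) - 2 * (u:ℂ) * t) / (2 * (u:ℂ)^2 * (Real.sinh u : ℂ))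
noncomputable def p1 (t : ℂ) (u : ℝ) : ℂ :=
  (Complex.cos (2 * (u:ℂ) * t) - 1) / ((u:ℂ) * (Real.sinh u : ℂ))
noncomputable def p2 (t : ℂ) (u : ℝ) : ℂ :=
  -2 * Complex.sin (2 * (u:ℂ) * t) / (Real.sinh u : ℂ)
noncomputable def ke (τ u : ℝ) : ℝ := (τ * u / Real.sinh (τ * u) - 1) / (2 * u^2 * Real.sinh u)
noncomputable def e0 (τ : ℝ) (t : ℂ) (u : ℝ) : ℂ := Complex.sin (2 * (u:ℂ) * t) * (ke τ u : ℂ)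
noncomputable def e1 (τ : ℝ) (t : ℂ) (u : ℝ) : ℂ :=
  2 * (u:ℂ) * Complex.cos (2 * (u:ℂ) * t) * (ke τ u : ℂ)

theorem aux_norm2 {u : ℝ} (hu : 0 < u) (t : ℂ) : ‖2 * (u:ℂ) * t‖ = 2 * u * ‖t‖ := by
  simp [abs_of_pos hu]

theorem aux_im2 {u : ℝ} (hu : 0 < u) (t : ℂ) : |(2 * (u:ℂ) * t).im| = 2 * u * |t.im| := by
  have : (2 * (u:ℂ) * t).im = 2 * u * t.im := by
    rw [show 2 * (u:ℂ) * t = ((2*u : ℝ) : ℂ) * t by push_cast; ring, Complex.im_ofReal_mul]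
  rw [this, abs_mul, abs_of_pos (by positivity)]

theorem p0_bd (t : ℂ) (u : ℝ) (hu : 0 < u) : ‖p0 t u‖ ≤ 4 * ‖t‖^3 * Bd u |t.im| := by
  have hs : 0 < Real.sinh u := Real.sinh_pos_iff.2 hu
  have h := aux_norm_sin_sub_le (2 * (u:ℂ) * t)
  rw [aux_norm2 hu, aux_im2 hu] at h
  have hn : ‖(2 * (u:ℂ)^2 * (Real.sinh u : ℂ))‖ = 2 * u^2 * Real.sinh u := by
    simp only [norm_mul, norm_pow, Complex.norm_real, Complex.norm_ofNat, Real.norm_eq_abs, abs_of_pos hu, abs_of_pos hs]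
  rw [p0, norm_div, hn, div_le_iff₀ (by positivity)]
  refine h.trans (le_of_eq ?_)
  unfold Bd; field_simp; ring

theorem p1_bd (t : ℂ) (u : ℝ) (hu : 0 < u) : ‖p1 t u‖ ≤ 4 * ‖t‖^2 * Bd u |t.im| := by
  have hs : 0 < Real.sinh u := Real.sinh_pos_iff.2 hu
  have h := aux_norm_cos_sub_le (2 * (u:ℂ) * t)
  rw [aux_norm2 hu, aux_im2 hu] at h
  have hn : ‖((u:ℂ) * (Real.sinh u : ℂ))‖ = u * Real.sinh u := by
    simp only [norm_mul, norm_pow, Complex.norm_real, Complex.norm_ofNat, Real.norm_eq_abs, abs_of_pos hu, abs_of_pos hs]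
  rw [p1, norm_div, hn, div_le_iff₀ (by positivity)]
  refine h.trans (le_of_eq ?_)
  unfold Bd; field_simp; ring

theorem p2_bd (t : ℂ) (u : ℝ) (hu : 0 < u) : ‖p2 t u‖ ≤ 4 * ‖t‖ * Bd u |t.im| := by
  have hs : 0 < Real.sinh u := Real.sinh_pos_iff.2 hu
  have h := aux_norm_sin_le (2 * (u:ℂ) * t)
  rw [aux_norm2 hu, aux_im2 hu] at h
  have hn : ‖((Real.sinh u : ℂ))‖ = Real.sinh u := by
    simp only [Complex.norm_real, Real.norm_eq_abs, abs_of_pos hs]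
  rw [p2, norm_div, hn, div_le_iff₀ (by positivity), norm_mul, norm_neg, Complex.norm_ofNat]
  refine (mul_le_mul_of_nonneg_left h (by norm_num)).trans (le_of_eq ?_)
  unfold Bd; field_simp; ring

theorem ke_bd {τ u : ℝ} (hτ : 0 < τ) (hu : 0 < u) : |ke τ u| ≤ τ^2 / (4 * Real.sinh u) := by
  have hs : 0 < Real.sinh u := Real.sinh_pos_iff.2 hu
  have h := (aux_one_sub (mul_pos hτ hu)).1
  rw [ke, abs_div, abs_of_pos (show 0 < 2 * u^2 * Real.sinh u by positivity), div_le_iff₀ (by positivity)]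
  refine h.trans (le_of_eq ?_)
  field_simp; ring

theorem e0_bd {τ : ℝ} (hτ : 0 < τ) (t : ℂ) (u : ℝ) (hu : 0 < u) :
    ‖e0 τ t u‖ ≤ τ^2/2 * ‖t‖ * Bd u |t.im| := by
  have hs : 0 < Real.sinh u := Real.sinh_pos_iff.2 hu
  have h := aux_norm_sin_le (2 * (u:ℂ) * t)
  rw [aux_norm2 hu, aux_im2 hu] at h
  rw [e0, norm_mul, Complex.norm_real, Real.norm_eq_abs]
  refine (mul_le_mul h (ke_bd hτ hu) (abs_nonneg _) (by positivity)).trans (le_of_eq ?_)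
  unfold Bd; field_simp; ring

theorem e1_bd {τ : ℝ} (hτ : 0 < τ) (t : ℂ) (u : ℝ) (hu : 0 < u) :
    ‖e1 τ t u‖ ≤ τ^2/2 * Bd u |t.im| := by
  have hs : 0 < Real.sinh u := Real.sinh_pos_iff.2 hu
  have h := aux_norm_cos_le (2 * (u:ℂ) * t)
  rw [aux_im2 hu] at h
  rw [e1, norm_mul, Complex.norm_real, Real.norm_eq_abs, norm_mul, norm_mul, Complex.norm_ofNat,
    Complex.norm_real, Real.norm_of_nonneg hu.le]
  refine (mul_le_mul (mul_le_mul_of_nonneg_left h (by positivity)) (ke_bd hτ hu) (abs_nonneg _) (by positivity)).trans (le_of_eq ?_)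
  unfold Bd; field_simp; ring

theorem aux_ne {u : ℝ} (hu : u ∈ Ioi (0:ℝ)) : (u:ℂ) ≠ 0 ∧ (Real.sinh u : ℂ) ≠ 0 ∧ Real.sinh u ≠ 0 ∧ u ≠ 0:= by
  have hs : 0 < Real.sinh u := Real.sinh_pos_iff.2 hu
  have hu : 0 < u := hu
  refine ⟨?_, ?_, hs.ne', hu.ne'⟩
  · exact_mod_cast hu.ne'
  · exact_mod_cast hs.ne'

theorem aux_cs : Continuous (fun u : ℝ => (Real.sinh u : ℂ)) :=
  Complex.continuous_ofReal.comp Real.continuous_sinh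

theorem p0_cont (t : ℂ) : ContinuousOn (p0 t) (Ioi 0) := by
  unfold p0
  have := aux_cs
  refine ContinuousOn.div (by fun_prop) (by fun_prop) fun u hu => ?_
  have := aux_ne hu
  exact mul_ne_zero (mul_ne_zero two_ne_zero (pow_ne_zero 2 this.1)) this.2.1

theorem p1_cont (t : ℂ) : ContinuousOn (p1 t) (Ioi 0) := by
  unfold p1
  have := aux_cs
  refine ContinuousOn.div (by fun_prop) (by fun_prop) fun u hu => ?_
  have := aux_ne hu
  exact mul_ne_zero this.1 this.2.1

theorem p2_cont (t : ℂ) : ContinuousOn (p2 t) (Ioi 0) := by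
  unfold p2
  have := aux_cs
  refine ContinuousOn.div (by fun_prop) (by fun_prop) fun u hu => ?_
  exact (aux_ne hu).2.1

theorem ke_cont {τ : ℝ} (hτ : 0 < τ) : ContinuousOn (fun u => (ke τ u : ℂ)) (Ioi 0) := by
  refine Complex.continuous_ofReal.comp_continuousOn ?_
  unfold ke
  refine ContinuousOn.div (ContinuousOn.sub (ContinuousOn.div (by fun_prop) (by fun_prop) ?_) (by fun_prop)) (by fun_prop) ?_
  · intro u hu
    exact (aux_ne (mul_pos hτ hu)).2.2.1
  · intro u hu
    have := aux_ne hu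
    simp only [ne_eq, mul_eq_zero, not_or]; simp [this.2.2]

theorem e0_cont {τ : ℝ} (hτ : 0 < τ) (t : ℂ) : ContinuousOn (e0 τ t) (Ioi 0) := by
  unfold e0
  exact ContinuousOn.mul (by fun_prop) (ke_cont hτ)

theorem e1_cont {τ : ℝ} (hτ : 0 < τ) (t : ℂ) : ContinuousOn (e1 τ t) (Ioi 0) := by
  unfold e1
  exact ContinuousOn.mul (by fun_prop) (ke_cont hτ)

theorem aux_hd (u : ℝ) (t : ℂ) : HasDerivAt (fun t : ℂ => 2 * (u:ℂ) * t) (2 * (u:ℂ)) t := by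
  simpa using (hasDerivAt_id t).const_mul (2 * (u:ℂ))

theorem p0_deriv (t : ℂ) (u : ℝ) (hu : 0 < u) : HasDerivAt (fun t => p0 t u) (p1 t u) t := by
  have := aux_ne hu
  unfold p0 p1
  refine ((((Complex.hasDerivAt_sin _).comp t (aux_hd u t)).sub (aux_hd u t)).div_const _).congr_deriv ?_
  field_simp [this.1, this.2.1]

theorem p1_deriv (t : ℂ) (u : ℝ) (hu : 0 < u) : HasDerivAt (fun t => p1 t u) (p2 t u) t := by
  have := aux_ne hu
  unfold p1 p2
  refine ((((Complex.hasDerivAt_cos _).comp t (aux_hd u t)).sub_const 1).div_const _).congr_deriv ?_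
  field_simp [this.1, this.2.1]

theorem e0_deriv (τ : ℝ) (t : ℂ) (u : ℝ) : HasDerivAt (fun t => e0 τ t u) (e1 τ t u) t := by
  unfold e0 e1
  refine (((Complex.hasDerivAt_sin _).comp t (aux_hd u t)).mul_const _).congr_deriv ?_
  ring

theorem aux_pow3 (t : ℂ) : ‖t‖^3 ≤ (1+‖t‖)^3 ∧ ‖t‖^2 ≤ (1+‖t‖)^3 ∧ ‖t‖ ≤ (1+‖t‖)^3 ∧ 1 ≤ (1+‖t‖)^3 := by
  have := norm_nonneg t
  refine ⟨?_, ?_, ?_, ?_⟩ <;> nlinarith [pow_nonneg this 2, pow_nonneg this 3]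

theorem p0_bd' (t : ℂ) (u : ℝ) (hu : 0 < u) : ‖p0 t u‖ ≤ 4 * (1+‖t‖)^3 * Bd u |t.im| := by
  refine (p0_bd t u hu).trans ?_
  have := Bd_nonneg hu |t.im|
  gcongr; linarith
theorem p1_bd' (t : ℂ) (u : ℝ) (hu : 0 < u) : ‖p1 t u‖ ≤ 4 * (1+‖t‖)^3 * Bd u |t.im| := by
  refine (p1_bd t u hu).trans ?_
  have := Bd_nonneg hu |t.im|
  gcongr; exact (aux_pow3 t).2.1
theorem p2_bd' (t : ℂ) (u : ℝ) (hu : 0 < u) : ‖p2 t u‖ ≤ 4 * (1+‖t‖)^3 * Bd u |t.im| := by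
  refine (p2_bd t u hu).trans ?_
  have := Bd_nonneg hu |t.im|
  gcongr; exact (aux_pow3 t).2.2.1
theorem e0_bd' {τ : ℝ} (hτ : 0 < τ) (t : ℂ) (u : ℝ) (hu : 0 < u) :
    ‖e0 τ t u‖ ≤ τ^2/2 * (1+‖t‖)^3 * Bd u |t.im| := by
  refine (e0_bd hτ t u hu).trans ?_
  have := Bd_nonneg hu |t.im|
  gcongr; exact (aux_pow3 t).2.2.1
theorem e1_bd' {τ : ℝ} (hτ : 0 < τ) (t : ℂ) (u : ℝ) (hu : 0 < u) :
    ‖e1 τ t u‖ ≤ τ^2/2 * (1+‖t‖)^3 * Bd u |t.im| := by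
  refine (e1_bd hτ t u hu).trans ?_
  have := Bd_nonneg hu |t.im|
  have h1 := (aux_pow3 t).2.2.2
  calc τ^2/2 * Bd u |t.im| = τ^2/2 * 1 * Bd u |t.im| := by ring
    _ ≤ _ := by gcongr

noncomputable def P0 (t : ℂ) : ℂ := ∫ u in Ioi (0:ℝ), p0 t u
noncomputable def P1f (t : ℂ) : ℂ := ∫ u in Ioi (0:ℝ), p1 t u
noncomputable def P2f (t : ℂ) : ℂ := ∫ u in Ioi (0:ℝ), p2 t u
noncomputable def Eb (τ : ℝ) (t : ℂ) : ℂ := ∫ u in Ioi (0:ℝ), e0 τ t u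

theorem P0_deriv (t : ℂ) (ht : t ∈ St) : HasDerivAt P0 (P1f t) t :=
  diff_int p0 p1 4 (by norm_num) p0_deriv p0_cont p1_cont p0_bd' p1_bd' t ht
theorem P1_deriv (t : ℂ) (ht : t ∈ St) : HasDerivAt P1f (P2f t) t :=
  diff_int p1 p2 4 (by norm_num) p1_deriv p1_cont p2_cont p1_bd' p2_bd' t ht
theorem Eb_diff {τ : ℝ} (hτ : 0 < τ) (t : ℂ) (ht : t ∈ St) : DifferentiableAt ℂ (Eb τ) t :=
  (diff_int (e0 τ) (e1 τ) (τ^2/2) (by positivity) (fun t u _ => e0_deriv τ t u) (e0_cont hτ) (e1_cont hτ)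
    (e0_bd' hτ) (e1_bd' hτ) t ht).differentiableAt

theorem Eb_bound {v : ℝ} (hv : v < 1/2) : ∃ C > 0, ∀ τ > 0, ∀ t : ℂ, |t.im| ≤ v →
    ‖Eb τ t‖ ≤ C * τ^2 * ‖t‖ := by
  have hI := Bd_integrable hv
  refine ⟨(∫ u in Ioi (0:ℝ), Bd u v) + 1, ?_, ?_⟩
  · have : 0 ≤ ∫ u in Ioi (0:ℝ), Bd u v :=
      setIntegral_nonneg measurableSet_Ioi fun u hu => Bd_nonneg hu v
    linarith
  · intro τ hτ t ht
    have : ‖Eb τ t‖ ≤ ∫ u in Ioi (0:ℝ), τ^2/2 * ‖t‖ * Bd u v := by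
      refine norm_integral_le_of_norm_le (hI.const_mul _) ?_
      refine (ae_restrict_iff' measurableSet_Ioi).2 (Eventually.of_forall fun u hu => ?_)
      have hu : 0 < u := hu
      refine (e0_bd hτ t u hu).trans ?_
      have := Bd_mono hu ht
      gcongr
    rw [integral_const_mul] at this
    have h0 : 0 ≤ ∫ u in Ioi (0:ℝ), Bd u v :=
      setIntegral_nonneg measurableSet_Ioi fun u hu => Bd_nonneg hu v
    refine this.trans ?_
    nlinarith [mul_nonneg (mul_nonneg (sq_nonneg τ) (norm_nonneg t)) h0, mul_nonneg (sq_nonneg τ) (norm_nonneg t)]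

noncomputable def kap (u : ℝ) : ℝ := (u / Real.sinh u - 1) / u^2

theorem kap_cont : ContinuousOn kap (Ioi 0) := by
  unfold kap
  refine ContinuousOn.div (ContinuousOn.sub (ContinuousOn.div (by fun_prop) (by fun_prop) ?_) (by fun_prop)) (by fun_prop) ?_
  · intro u hu
    exact (aux_ne hu).2.2.1
  · intro u hu
    exact pow_ne_zero 2 (aux_ne hu).2.2.2

theorem kap_int : IntegrableOn kap (Ioi 0) := by
  refine Integrable.mono' (g := fun u : ℝ => 2 * (1 + u^2)⁻¹) ((integrable_inv_one_add_sq.const_mul 2).integrableOn)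
    (kap_cont.aestronglyMeasurable measurableSet_Ioi) ?_
  refine (ae_restrict_iff' measurableSet_Ioi).2 (Eventually.of_forall fun u hu => ?_)
  have hu : 0 < u := hu
  have h := aux_one_sub hu
  rw [kap, norm_div, Real.norm_eq_abs, Real.norm_of_nonneg (by positivity), div_le_iff₀ (by positivity), ← div_eq_mul_inv, div_mul_eq_mul_div,
    le_div_iff₀ (by positivity)]
  nlinarith [mul_nonneg (abs_nonneg (u / Real.sinh u - 1)) (sq_nonneg u), sq_nonneg u]

/-- decomposition of `Lb` -/
theorem Lb_decomp {b : ℝ} (hb : 0 < b) (t : ℂ) (ht : t ∈ St) :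
    Lb b (t / b) = Complex.I / (b:ℂ)^2 *
      (P0 t + t * ((∫ u in Ioi (0:ℝ), kap u : ℝ) : ℂ) + Eb (b^2) t) := by
  have hb' : (b:ℂ) ≠ 0 := by exact_mod_cast hb.ne'
  have hτ : 0 < b^2 := by positivity
  have i0 : IntegrableOn (p0 t) (Ioi 0) := integ_of_bd p0 4 t ht (p0_cont t) (p0_bd' t)
  have ie : IntegrableOn (e0 (b^2) t) (Ioi 0) := integ_of_bd (e0 (b^2)) _ t ht (e0_cont hτ t) (e0_bd' hτ t)
  have ik : IntegrableOn (fun u => t * (kap u : ℂ)) (Ioi 0) := (kap_int.ofReal (𝕜 := ℂ)).const_mul t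
  have is : IntegrableOn (fun a => p0 t a + t * (kap a : ℂ)) (Ioi 0) := i0.add ik
  have hcv := integral_comp_mul_left_Ioi' (fun y : ℝ => (Complex.sin (2 * (y:ℂ) * (t/b)) / (2 * (Real.sinh (y / b) : ℂ) * (Real.sinh (b * y) : ℂ))
      - (t/b) / (y:ℂ)) / (y:ℂ)) 0 hb
  rw [mul_zero] at hcv
  rw [Lb, ← hcv]
  have hk : ((∫ u in Ioi (0:ℝ), kap u : ℝ) : ℂ) = ∫ u in Ioi (0:ℝ), (kap u : ℂ) := integral_ofReal.symm
  rw [P0, Eb, hk, ← integral_const_mul, ← integral_add i0 ik,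
    ← integral_add is ie, ← integral_const_mul,
    ← integral_smul, ← integral_const_mul]
  refine setIntegral_congr_fun measurableSet_Ioi fun u hu => ?_
  obtain ⟨h1, h2, h3, h4⟩ := aux_ne hu
  have h5 := (aux_ne (mul_pos hτ hu : b^2 * u ∈ Ioi 0)).2.1
  have e1 : b * u / b = u := by field_simp
  have e2 : b * (b * u) = b^2 * u := by ring
  have e3 : 2 * ((b * u : ℝ) : ℂ) * (t / b) = 2 * (u:ℂ) * t := by push_cast; field_simp
  simp only [e1, e2, e3, p0, e0, ke, kap, Complex.real_smul]
  push_cast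
  push_cast at h2 h5
  field_simp
  ring


theorem aux_q (t : ℂ) (n : ℕ) (u : ℝ) (hu : 0 < u) :
    p2 t u * (Complex.exp (-(2*n*u)) - Complex.exp (-(2*(n+1)*u))) =
      -2 * Complex.I * (Complex.exp ((-(2*n+1) - 2*Complex.I*t) * u)
        - Complex.exp ((-(2*n+1) + 2*Complex.I*t) * u)) := by
  have h := (aux_ne hu).2.1
  have e1 : Complex.exp (-(2*n*u)) - Complex.exp (-(2*(n+1)*u))
      = 2 * (Real.sinh u : ℂ) * Complex.exp (-((2*n+1)*u)) := by
    rw [Complex.ofReal_sinh, Complex.sinh, show 2 * ((Complex.exp u - Complex.exp (-u))/2) * Complex.exp (-((2*n+1)*(u:ℂ)))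
      = Complex.exp u * Complex.exp (-((2*n+1)*(u:ℂ))) - Complex.exp (-u) * Complex.exp (-((2*n+1)*(u:ℂ))) by ring,
      ← Complex.exp_add, ← Complex.exp_add]
    congr 2 <;> ring
  rw [e1, p2, Complex.sin]
  have e2 : Complex.exp ((-(2*n+1) - 2*Complex.I*t) * u) = Complex.exp (-(2 * u * t) * Complex.I) * Complex.exp (-((2*n+1)*u)) := by
    rw [← Complex.exp_add]; congr 1; ring
  have e3 : Complex.exp ((-(2*n+1) + 2*Complex.I*t) * u) = Complex.exp ((2 * u * t) * Complex.I) * Complex.exp (-((2*n+1)*u)) := by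
    rw [← Complex.exp_add]; congr 1; ring
  rw [e2, e3]
  field_simp

theorem aux_sumq (t : ℂ) (N : ℕ) (u : ℝ) (hu : 0 < u) :
    ∑ n ∈ Finset.range N, -2 * Complex.I * (Complex.exp ((-(2*n+1) - 2*Complex.I*t) * u)
        - Complex.exp ((-(2*n+1) + 2*Complex.I*t) * u)) = p2 t u * (1 - Complex.exp (-(2*N*u))) := by
  induction N with
  | zero => simp
  | succ k ih => rw [Finset.sum_range_succ, ih, ← aux_q t k u hu]; push_cast; ring

theorem aux_re (t : ℂ) (ht : t ∈ St) (n : ℕ) : (-(2*n+1) - 2*Complex.I*t : ℂ).re < 0 ∧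
    (-(2*n+1) + 2*Complex.I*t : ℂ).re < 0 := by
  have ht : |t.im| < 1/2 := ht
  rw [abs_lt] at ht
  have : (0:ℝ) ≤ n := n.cast_nonneg
  constructor <;> simp <;> linarith

theorem aux_intq (t : ℂ) (ht : t ∈ St) (n : ℕ) :
    IntegrableOn (fun u : ℝ => -2 * Complex.I * (Complex.exp ((-(2*n+1) - 2*Complex.I*t) * u)
        - Complex.exp ((-(2*n+1) + 2*Complex.I*t) * u))) (Ioi 0) ∧
    ∫ u in Ioi (0:ℝ), -2 * Complex.I * (Complex.exp ((-(2*n+1) - 2*Complex.I*t) * u)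
        - Complex.exp ((-(2*n+1) + 2*Complex.I*t) * u)) =
      -Complex.I * (1 / ((1/2 + Complex.I * t) + n) + 1 / ((1/2 + Complex.I * t) - (n+1))) := by
  obtain ⟨h1, h2⟩ := aux_re t ht n
  have i1 := integrableOn_exp_mul_complex_Ioi h1 0
  have i2 := integrableOn_exp_mul_complex_Ioi h2 0
  refine ⟨(i1.sub i2).const_mul _, ?_⟩
  rw [integral_const_mul, integral_sub i1 i2, integral_exp_mul_complex_Ioi h1, integral_exp_mul_complex_Ioi h2]
  have n1 : (-(2*n+1) - 2*Complex.I*t : ℂ) ≠ 0 := fun h => by rw [h] at h1; simp at h1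
  have n2 : (-(2*n+1) + 2*Complex.I*t : ℂ) ≠ 0 := fun h => by rw [h] at h2; simp at h2
  have e1 : (1/2 + Complex.I * t) + n = -(-(2*n+1) - 2*Complex.I*t : ℂ)/2 := by ring
  have e2 : (1/2 + Complex.I * t) - (n+1) = (-(2*n+1) + 2*Complex.I*t : ℂ)/2 := by ring
  rw [e1, e2]
  simp only [Complex.ofReal_zero, mul_zero, Complex.exp_zero]
  field_simp
  ring

theorem P2_val (t : ℂ) (ht : t ∈ St) :
    P2f t = Real.pi - 2 * Real.pi * Complex.exp (2*Real.pi*t) / (1 + Complex.exp (2*Real.pi*t)) := by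
  set x : ℂ := 1/2 + Complex.I * t with hx
  have ht' : |t.im| < 1/2 := ht
  rw [abs_lt] at ht'
  have hxc : x ∈ Complex.integerComplement := by
    rintro ⟨m, hm⟩
    have h1 : (m : ℝ) = 1/2 - t.im := by
      have := congrArg Complex.re hm
      simp [hx] at this
      linarith
    have a : (0:ℝ) < m := by linarith
    have b : (m:ℝ) < 1 := by linarith
    have a' : (0:ℤ) < m := by exact_mod_cast a
    have b' : m < (1:ℤ) := by exact_mod_cast b
    omega
  have L1 : Tendsto (fun N : ℕ => ∫ u in Ioi (0:ℝ), p2 t u * (1 - Complex.exp (-(2*N*u)))) atTop (𝓝 (P2f t)) := by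
    refine MeasureTheory.tendsto_integral_of_dominated_convergence (fun u => ‖p2 t u‖) ?_ ?_ ?_ ?_
    · intro N
      refine ContinuousOn.aestronglyMeasurable (ContinuousOn.mul (p2_cont t) (by fun_prop)) measurableSet_Ioi
    · exact (integ_of_bd p2 4 t ht (p2_cont t) (p2_bd' t)).norm
    · intro N
      refine (ae_restrict_iff' measurableSet_Ioi).2 (Eventually.of_forall fun u hu => ?_)
      have hu : 0 < u := hu
      have e : (1 - Complex.exp (-(2*N*u)) : ℂ) = ((1 - Real.exp (-(2*N*u)) : ℝ) : ℂ) := by push_cast; rfl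
      rw [norm_mul, e, Complex.norm_real, Real.norm_of_nonneg]
      · have := Real.exp_pos (-(2*N*u))
        nlinarith [norm_nonneg (p2 t u)]
      · have : Real.exp (-(2*N*u)) ≤ 1 := Real.exp_le_one_iff.2 (by have : (0:ℝ) ≤ N := N.cast_nonneg
                                                                    nlinarith [mul_nonneg this hu.le])
        linarith
    · refine (ae_restrict_iff' measurableSet_Ioi).2 (Eventually.of_forall fun u hu => ?_)
      have hu : 0 < u := hu
      have h1 : Tendsto (fun N : ℕ => Complex.exp (-(2*N*u))) atTop (𝓝 0) := by
        have h2 : Tendsto (fun N : ℕ => (Real.exp (-(2*u)))^N) atTop (𝓝 0) :=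
          tendsto_pow_atTop_nhds_zero_of_lt_one (Real.exp_pos _).le (Real.exp_lt_one_iff.2 (by linarith))
        have h3 := (Complex.continuous_ofReal.tendsto 0).comp h2
        rw [Complex.ofReal_zero] at h3
        refine h3.congr fun N => ?_
        simp only [Function.comp, Complex.ofReal_pow, Complex.ofReal_exp, ← Complex.exp_nat_mul]
        congr 1; push_cast; ring
      simpa using (h1.const_sub 1).const_mul (p2 t u)
  have L2 : ∀ N : ℕ, ∫ u in Ioi (0:ℝ), p2 t u * (1 - Complex.exp (-(2*N*u))) =
      -Complex.I * (∑ j ∈ Finset.range N, cotTerm x j + 1/x - 1/(x+N)) := by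
    intro N
    have e1 : ∫ u in Ioi (0:ℝ), p2 t u * (1 - Complex.exp (-(2*N*u))) =
        ∑ n ∈ Finset.range N, -Complex.I * (1 / (x + n) + 1 / (x - (n+1))) := by
      rw [← setIntegral_congr_fun measurableSet_Ioi (fun u hu => aux_sumq t N u hu),
        integral_finsetSum _ (fun n _ => (aux_intq t ht n).1)]
      exact Finset.sum_congr rfl fun n _ => (aux_intq t ht n).2
    rw [e1, ← Finset.mul_sum]
    congr 1
    induction N with
    | zero => simp
    | succ k ih =>
      rw [Finset.sum_range_succ, Finset.sum_range_succ, cotTerm]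
      have ih' := ih ?_
      · rw [ih']; push_cast; ring_nf
      · rw [← setIntegral_congr_fun measurableSet_Ioi (fun u hu => aux_sumq t k u hu),
          integral_finsetSum _ (fun n _ => (aux_intq t ht n).1)]
        exact Finset.sum_congr rfl fun n _ => (aux_intq t ht n).2
  have L3 : Tendsto (fun N : ℕ => 1/(x+N)) atTop (𝓝 0) := by
    simp only [one_div]
    refine tendsto_inv₀_cobounded.comp ?_
    have : Tendsto (fun N : ℕ => (N:ℂ)) atTop (Bornology.cobounded ℂ) := by
      rw [← tendsto_norm_atTop_iff_cobounded]
      simpa using tendsto_natCast_atTop_atTop (R := ℝ)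
    exact tendsto_const_add_cobounded x |>.comp this
  have L4 := (((tendsto_logDeriv_euler_cot_sub hxc).add_const (1/x)).sub L3).const_mul (-Complex.I)
  have L5 : Tendsto (fun N : ℕ => ∫ u in Ioi (0:ℝ), p2 t u * (1 - Complex.exp (-(2*N*u)))) atTop
    (𝓝 (-Complex.I * (Real.pi * Complex.cot (Real.pi * x) - 1/x + 1/x - 0))) := by
    refine L4.congr fun N => (L2 N).symm
  rw [tendsto_nhds_unique L1 L5, Complex.cot_eq_exp_ratio]
  have e : Complex.exp (2 * Complex.I * (Real.pi * x)) = - (Complex.exp (2*Real.pi*t))⁻¹ := by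
    rw [hx, show 2 * Complex.I * (Real.pi * (1/2 + Complex.I * t)) = Real.pi * Complex.I - 2*Real.pi*t by
      linear_combination (2 * Real.pi * t) * Complex.I_sq, Complex.exp_sub, Complex.exp_pi_mul_I]
    ring
  rw [e]
  have hE := Complex.exp_ne_zero (2*Real.pi*t)
  have h1 : 1 + Complex.exp (2*Real.pi*t) ≠ 0 := by
    intro h
    have h2 : Complex.exp (2*Real.pi*t) = Complex.exp (Real.pi * Complex.I) := by
      rw [Complex.exp_pi_mul_I]; linear_combination h
    obtain ⟨n, hn⟩ := Complex.exp_eq_exp_iff_exists_int.1 h2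
    have h3 := congrArg Complex.im hn
    simp at h3
    have h4 : t.im = 1/2 + n := by
      have := Real.pi_pos
      apply mul_left_cancel₀ (show (2*Real.pi) ≠ 0 by positivity); linarith
    have a : (n:ℝ) < 0 := by linarith
    have b : (-1:ℝ) < n := by linarith
    have a' : n < (0:ℤ) := by exact_mod_cast a
    have b' : (-1:ℤ) < n := by exact_mod_cast b
    omega
  have h3 : (1 - -(Complex.exp (2*Real.pi*t))⁻¹) ≠ 0 := by
    rw [show (1 - -(Complex.exp (2*Real.pi*t))⁻¹) = (1 + Complex.exp (2*Real.pi*t)) / Complex.exp (2*Real.pi*t) by field_simp; ring]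
    exact div_ne_zero h1 hE
  have hI := Complex.I_ne_zero
  generalize Complex.exp (2*Real.pi*t) = w at *
  have h4 : w + 1 ≠ 0 := by rwa [add_comm]
  rw [show (1 - -w⁻¹) = (1 + w) / w by field_simp; ring]
  field_simp
  ring


theorem slit_mem (t : ℂ) (ht : t ∈ St) : 1 + Complex.exp (2*Real.pi*t) ∈ Complex.slitPlane := by
  have ht' : |t.im| < 1/2 := ht
  rw [abs_lt] at ht'
  have hpi := Real.pi_pos
  rw [Complex.mem_slitPlane_iff]
  have hre : (2*Real.pi*t : ℂ).re = 2*Real.pi*t.re := by simp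
  have him : (2*Real.pi*t : ℂ).im = 2*Real.pi*t.im := by simp
  by_cases h : t.im = 0
  · left
    rw [Complex.add_re, Complex.exp_re, him, h]
    simp
    positivity
  · right
    rw [Complex.add_im, Complex.exp_im, him, Complex.one_im, zero_add]
    refine mul_ne_zero (Real.exp_pos _).ne' ?_
    intro hs
    rw [Real.sin_eq_zero_iff_of_lt_of_lt (by nlinarith) (by nlinarith)] at hs
    apply h
    have := mul_eq_zero.1 hs
    rcases this with h1 | h1
    · nlinarith
    · exact h1

theorem exp2_deriv (t : ℂ) : HasDerivAt (fun t : ℂ => Complex.exp (2*Real.pi*t))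
    (2*Real.pi*Complex.exp (2*Real.pi*t)) t := by
  have h1 : HasDerivAt (fun t : ℂ => 2*Real.pi*t) (2*Real.pi) t := by
    simpa using (hasDerivAt_id t).const_mul (2*Real.pi : ℂ)
  refine h1.cexp.congr_deriv ?_
  ring

theorem logf_deriv (t : ℂ) (ht : t ∈ St) :
    HasDerivAt (fun t : ℂ => Complex.log (1 + Complex.exp (2*Real.pi*t)))
      (2 * Real.pi * Complex.exp (2*Real.pi*t) / (1 + Complex.exp (2*Real.pi*t))) t :=
  ((exp2_deriv t).const_add 1).clog (slit_mem t ht)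

theorem St_zero : (0:ℂ) ∈ St := by simp [St]

theorem St_eq (f g h : ℂ → ℂ) (hf : ∀ t ∈ St, HasDerivAt f (h t) t)
    (hg : ∀ t ∈ St, HasDerivAt g (h t) t) (h0 : f 0 = g 0) : ∀ t ∈ St, f t = g t := by
  intro t ht
  refine IsOpen.eqOn_of_deriv_eq St_open St_convex.isPreconnected
    (fun z hz => (hf z hz).differentiableAt.differentiableWithinAt)
    (fun z hz => (hg z hz).differentiableAt.differentiableWithinAt)
    (fun z hz => by rw [(hf z hz).deriv, (hg z hz).deriv]) St_zero h0 ht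

theorem P1_val (t : ℂ) (ht : t ∈ St) :
    P1f t = Real.pi * t - Complex.log (1 + Complex.exp (2*Real.pi*t)) + Real.log 2 := by
  refine St_eq P1f (fun t => Real.pi * t - Complex.log (1 + Complex.exp (2*Real.pi*t)) + Real.log 2)
    _ (fun t ht => (P1_deriv t ht).congr_deriv (P2_val t ht)) ?_ ?_ t ht
  · intro t ht
    have h1 : HasDerivAt (fun t : ℂ => Real.pi*t) (Real.pi) t := by
      simpa using (hasDerivAt_id t).const_mul (Real.pi : ℂ)
    exact (h1.sub (logf_deriv t ht)).add_const _
  · have : P1f 0 = 0 := by simp [P1f, p1]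
    rw [this]
    simp only [mul_zero, Complex.exp_zero]
    rw [show (1+1:ℂ) = ((2:ℝ):ℂ) by push_cast; norm_num, ← Complex.ofReal_log (by norm_num)]
    ring

theorem kap_val : ∫ u in Ioi (0:ℝ), kap u = -Real.log 2 := by
  set K := ∫ u in Ioi (0:ℝ), kap u with hK
  have hI : Complex.I/4 ∈ St := by
    simp [St]; norm_num
  have i1 : IntegrableOn (p1 (Complex.I/4)) (Ioi 0) := integ_of_bd p1 4 _ hI (p1_cont _) (p1_bd' _)
  have i2 : IntegrableOn (fun u => (kap u : ℂ)) (Ioi 0) := kap_int.ofReal (𝕜 := ℂ)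
  have h1 : P1f (Complex.I/4) + (K:ℂ) = (K:ℂ)/2 := by
    have hk : (K : ℂ) = ∫ u in Ioi (0:ℝ), (kap u : ℂ) := integral_ofReal.symm
    have h2 : ∫ u in Ioi (0:ℝ), (kap ((1/2)*u) : ℂ) = 2 * (K:ℂ) := by
      have := integral_comp_mul_left_Ioi (fun u : ℝ => (kap u : ℂ)) 0 (show (0:ℝ) < 1/2 by norm_num)
      rw [this, mul_zero, ← hk]; simp
    have h3 : (K:ℂ)/2 = ∫ u in Ioi (0:ℝ), (1/4 : ℂ) * (kap ((1/2)*u) : ℂ) := by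
      rw [integral_const_mul, h2]; ring
    rw [h3, hk, P1f, ← integral_add i1 i2]
    refine setIntegral_congr_fun measurableSet_Ioi fun u hu => ?_
    have hu' : 0 < u := hu
    obtain ⟨a1, a2, a3, a4⟩ := aux_ne hu
    have a5 : Real.sinh (1/2*u) ≠ 0 := (Real.sinh_pos_iff.2 (by positivity)).ne'
    have a6 : Real.cosh (1/2*u) ≠ 0 := (Real.cosh_pos _).ne'
    have e1 : Complex.cos (2 * (u:ℂ) * (Complex.I/4)) = (Real.cosh (1/2*u) : ℂ) := by
      rw [show 2 * (u:ℂ) * (Complex.I/4) = ((1/2*u : ℝ):ℂ) * Complex.I by push_cast; ring, Complex.cos_mul_I,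
        Complex.ofReal_cosh]
    have e2 : Real.sinh u = 2 * Real.sinh (1/2*u) * Real.cosh (1/2*u) := by
      rw [← Real.sinh_two_mul]; congr 1; ring
    simp only [p1, e1, kap]
    rw [e2]
    have : (((Real.cosh (1/2*u) - 1) / (u * (2 * Real.sinh (1/2*u) * Real.cosh (1/2*u))) + (u / (2 * Real.sinh (1/2*u) * Real.cosh (1/2*u)) - 1) / u^2 : ℝ)) =
      (1/4 * ((1/2 * u / Real.sinh (1/2*u) - 1) / (1/2*u)^2) : ℝ) := by
      field_simp
      ring
    have h5 := congrArg (fun x : ℝ => (x : ℂ)) this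
    push_cast at h5 ⊢
    exact h5
  rw [P1_val _ hI] at h1
  have h2 := congrArg Complex.re h1
  have e3 : Complex.exp (2*Real.pi*(Complex.I/4)) = Complex.I := by
    rw [show (2*Real.pi*(Complex.I/4) : ℂ) = Real.pi/2 * Complex.I by ring, Complex.exp_pi_div_two_mul_I]
  rw [e3] at h2
  have e4 : ‖(1 + Complex.I : ℂ)‖ = Real.sqrt 2 := by
    rw [Complex.norm_eq_sqrt_sq_add_sq]; norm_num
  simp [Complex.log_re, e4] at h2
  rw [Real.log_sqrt (by norm_num)] at h2
  linarith

theorem slit_seg (z : ℂ) (hz : 1 - z ∈ Complex.slitPlane) (s : ℝ) (hs : s ∈ Icc (0:ℝ) 1) :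
    1 - (s:ℂ) * z ∈ Complex.slitPlane := by
  have := Complex.starConvex_one_slitPlane hz (show 0 ≤ 1 - s by linarith [hs.2]) hs.1 (by ring)
  convert this using 1
  simp
  ring


theorem logs_deriv (z : ℂ) (s : ℝ) (h : 1 - (s:ℂ) * z ∈ Complex.slitPlane) :
    HasDerivAt (fun s : ℝ => Complex.log (1 - (s:ℂ) * z)) (-z / (1 - (s:ℂ)*z)) s := by
  have h1 : HasDerivAt (fun s : ℝ => 1 - (s:ℂ) * z) (-z) s := by
    have := ((Complex.ofRealCLM.hasDerivAt (x := s)).mul_const z).const_sub 1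
    simpa using this
  exact h1.clog_real h

theorem li_integrable (z : ℂ) (hz : 1 - z ∈ Complex.slitPlane) :
    IntervalIntegrable (fun s : ℝ => Complex.log (1 - (s:ℂ) * z) / (s:ℂ)) volume 0 1 := by
  set g : ℝ → ℂ := fun s => Complex.log (1 - (s:ℂ) * z) with hg
  set U : Set ℝ := {s | 1 - (s:ℂ)*z ∈ Complex.slitPlane} with hU
  have hUo : IsOpen U := Complex.isOpen_slitPlane.preimage (by fun_prop)
  have h0 : (0:ℝ) ∈ U := by simp [hU]
  have hc : ContinuousOn (dslope g 0) U := by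
    rw [continuousOn_dslope (hUo.mem_nhds h0)]
    exact ⟨fun s hs => (logs_deriv z s hs).continuousAt.continuousWithinAt,
      (logs_deriv z 0 h0).differentiableAt⟩
  have hi : IntervalIntegrable (dslope g 0) volume 0 1 := by
    refine ContinuousOn.intervalIntegrable (hc.mono ?_)
    rw [uIcc_of_le zero_le_one]
    exact fun s hs => slit_seg z hz s hs
  refine hi.congr ?_
  intro s hs
  rw [uIoc_of_le zero_le_one] at hs
  show dslope g 0 s = _
  rw [dslope_of_ne _ hs.1.ne', slope_def_module]
  simp [hg, div_eq_inv_mul]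

theorem Li2_deriv (z : ℂ) (hz : 1 - z ∈ Complex.slitPlane) (hz0 : z ≠ 0) :
    HasDerivAt Li2 (-Complex.log (1 - z) / z) z := by
  set V : Set ℂ := {z | 1 - z ∈ Complex.slitPlane} with hV
  have hVo : IsOpen V := Complex.isOpen_slitPlane.preimage (by fun_prop)
  obtain ⟨r, hr, hrV⟩ := Metric.nhds_basis_closedBall.mem_iff.1 (hVo.mem_nhds hz)
  obtain ⟨C, hC⟩ : ∃ C, ∀ p ∈ (Icc (0:ℝ) 1) ×ˢ (Metric.closedBall z r), ‖(1 - (p.1:ℂ) * p.2)⁻¹‖ ≤ C := by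
    refine (isCompact_Icc.prod (isCompact_closedBall z r)).exists_bound_of_continuousOn ?_
    refine ContinuousOn.inv₀ (by fun_prop) ?_
    rintro ⟨s, w⟩ ⟨hs, hw⟩
    exact Complex.slitPlane_ne_zero (slit_seg w (hrV hw) s hs)
  have key := (intervalIntegral.hasDerivAt_integral_of_dominated_loc_of_deriv_le (μ := volume) (a := 0) (b := 1)
    (F := fun (w : ℂ) (s : ℝ) => Complex.log (1 - (s:ℂ) * w) / (s:ℂ))
    (F' := fun (w : ℂ) (s : ℝ) => -(1 - (s:ℂ) * w)⁻¹) (bound := fun _ => C)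
    (Metric.closedBall_mem_nhds z hr) ?_ (li_integrable z hz) ?_ ?_ ?_ ?_).2
  · have e : ∫ s in (0:ℝ)..1, -(1 - (s:ℂ) * z)⁻¹ = Complex.log (1 - z) / z := by
      rw [intervalIntegral.integral_eq_sub_of_hasDerivAt (f := fun s : ℝ => Complex.log (1 - (s:ℂ)*z) / z)]
      · simp
      · intro s hs
        rw [uIcc_of_le zero_le_one] at hs
        have hs' := slit_seg z hz s hs
        refine ((logs_deriv z s hs').div_const z).congr_deriv ?_
        have := Complex.slitPlane_ne_zero hs'
        field_simp
      · refine ContinuousOn.intervalIntegrable (ContinuousOn.neg (ContinuousOn.inv₀ (by fun_prop) ?_))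
        intro s hs
        rw [uIcc_of_le zero_le_one] at hs
        exact Complex.slitPlane_ne_zero (slit_seg z hz s hs)
    rw [e] at key
    have := key.neg
    rw [neg_div]
    exact this
  · filter_upwards [hVo.mem_nhds hz] with w hw
    exact (intervalIntegrable_iff.1 (li_integrable w hw)).aestronglyMeasurable
  · refine ContinuousOn.aestronglyMeasurable (ContinuousOn.neg (ContinuousOn.inv₀ (by fun_prop) ?_)) measurableSet_uIoc
    intro s hs
    rw [uIoc_of_le zero_le_one] at hs
    exact Complex.slitPlane_ne_zero (slit_seg z hz s ⟨hs.1.le, hs.2⟩)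
  · refine Eventually.of_forall fun s hs w hw => ?_
    rw [uIoc_of_le zero_le_one] at hs
    rw [norm_neg]
    exact hC (s, w) ⟨⟨hs.1.le, hs.2⟩, hw⟩
  · exact intervalIntegrable_const
  · refine Eventually.of_forall fun s hs w hw => ?_
    rw [uIoc_of_le zero_le_one] at hs
    have hs' := slit_seg w (hrV hw) s ⟨hs.1.le, hs.2⟩
    have h1 : HasDerivAt (fun w : ℂ => 1 - (s:ℂ) * w) (-(s:ℂ)) w := by
      simpa using ((hasDerivAt_id w).const_mul (s:ℂ)).const_sub 1
    refine ((h1.clog hs').div_const (s:ℂ)).congr_deriv ?_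
    have := Complex.slitPlane_ne_zero hs'
    have h3 : (s:ℂ) ≠ 0 := by exact_mod_cast hs.1.ne'
    field_simp



theorem alt_zeta : HasSum (fun n : ℕ => (-1:ℝ)^n / (n:ℝ)^2) (-(Real.pi^2/12)) := by
  have h := hasSum_zeta_two
  set f : ℕ → ℝ := fun n => 1 / (n:ℝ)^2 with hf
  set g : ℕ → ℝ := fun n => (-1:ℝ)^n / (n:ℝ)^2 with hg
  have f2 : ∀ k, f (2*k) = f k / 4 := by
    intro k
    simp only [hf]
    push_cast
    rw [mul_pow]
    by_cases hk : (k:ℝ) = 0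
    · simp [hk]
    · field_simp; norm_num
  have g2 : ∀ k, g (2*k) = f (2*k) := by
    intro k
    simp [hf, hg, pow_mul]
  have g3 : ∀ k, g (2*k+1) = -f (2*k+1) := by
    intro k
    simp only [hf, hg]
    rw [pow_succ, pow_mul]
    norm_num [neg_div]
  have he : HasSum (fun k : ℕ => f (2*k)) (Real.pi^2/6/4) := by
    simp_rw [f2]
    exact h.div_const 4
  have ho : Summable (fun k : ℕ => f (2*k+1)) :=
    h.summable.comp_injective (i := fun k => 2*k+1) (fun a b hab => by simpa using hab)
  obtain ⟨S, hS⟩ := ho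
  have h1 := (he.even_add_odd hS).unique h
  have h2 : HasSum (fun k : ℕ => g (2*k)) (Real.pi^2/6/4) := by
    simp_rw [g2]; exact he
  have h3 : HasSum (fun k : ℕ => g (2*k+1)) (-S) := by
    simp_rw [g3]; exact hS.neg
  have h4 := h2.even_add_odd h3
  have : -(Real.pi^2/12) = Real.pi^2/6/4 + -S := by linarith
  rw [this]
  exact h4

theorem Li2_neg_one : Li2 (-1) = -((Real.pi:ℂ)^2/12) := by
  have hF : ∀ n : ℕ, ∀ t ∈ Ioc (0:ℝ) 1, ‖((-(t:ℂ))^(n+1) / ((n+1:ℕ):ℂ) / (t:ℂ))‖ = t^n/(n+1) := by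
    intro n t ht
    have : (t:ℝ) ≠ 0 := ht.1.ne'
    rw [norm_div, norm_div, norm_pow, norm_neg, Complex.norm_real, Complex.norm_natCast,
      Real.norm_of_nonneg ht.1.le]
    push_cast
    field_simp
    ring
  have hint : ∀ n : ℕ, ∫ t in Ioc (0:ℝ) 1, t^n/((n:ℝ)+1) = 1/((n:ℝ)+1)^2 := by
    intro n
    rw [← intervalIntegral.integral_of_le zero_le_one, intervalIntegral.integral_div, integral_pow]
    simp
    field_simp
  have hfe : ∀ n : ℕ, EqOn (fun t : ℝ => ((-(t:ℂ))^(n+1) / ((n+1:ℕ):ℂ) / (t:ℂ)))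
       (fun t : ℝ => (((-1)^(n+1) * (t^n/((n:ℝ)+1)) : ℝ) : ℂ)) (Ioc 0 1) := by
    intro n t ht
    have : (t:ℂ) ≠ 0 := by exact_mod_cast ht.1.ne'
    have : ((n:ℂ)+1) ≠ 0 := by exact_mod_cast n.succ_ne_zero
    simp only
    push_cast
    rw [neg_pow]
    field_simp
    ring
  have key := MeasureTheory.hasSum_integral_of_summable_integral_norm (μ := volume.restrict (Ioc (0:ℝ) 1))
    (F := fun (n : ℕ) (t : ℝ) => ((-(t:ℂ))^(n+1) / ((n+1:ℕ):ℂ) / (t:ℂ))) ?_ ?_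
  · have e1 : ∀ n : ℕ, ∫ t in Ioc (0:ℝ) 1, ((-(t:ℂ))^(n+1) / ((n+1:ℕ):ℂ) / (t:ℂ))
        = (((-1)^(n+1) / ((n+1:ℕ):ℝ)^2 : ℝ) : ℂ) := by
      intro n
      rw [setIntegral_congr_fun measurableSet_Ioc (hfe n), integral_complex_ofReal,
        integral_const_mul, hint]
      push_cast
      ring
    have e2 : HasSum (fun n : ℕ => (((-1)^(n+1) / ((n+1:ℕ):ℝ)^2 : ℝ) : ℂ)) ((-(Real.pi^2/12) : ℝ) : ℂ) := by
      rw [Complex.hasSum_ofReal]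
      have := (hasSum_nat_add_iff' (f := fun n : ℕ => (-1:ℝ)^n / (n:ℝ)^2) 1).2 alt_zeta
      simpa using this
    simp_rw [e1] at key
    have e3 := key.unique e2
    rw [Li2, intervalIntegral.integral_of_le zero_le_one]
    rw [← integral_neg]
    rw [show -((Real.pi:ℂ)^2/12) = ((-(Real.pi^2/12) : ℝ) : ℂ) by push_cast; ring, ← e3]
    rw [integral_Ioc_eq_integral_Ioo, integral_Ioc_eq_integral_Ioo]
    refine setIntegral_congr_fun measurableSet_Ioo fun t ht => ?_
    have h5 := Complex.hasSum_taylorSeries_neg_log (z := -(t:ℂ)) (by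
      rw [norm_neg, Complex.norm_real, Real.norm_of_nonneg ht.1.le]; exact ht.2)
    have h6 := (hasSum_nat_add_iff' 1).2 h5
    simp only [Finset.range_one, Finset.sum_singleton, Nat.cast_zero, div_zero, sub_zero] at h6
    have h7 := (h6.div_const (t:ℂ)).tsum_eq
    rw [h7]
    rw [neg_div]
    ring_nf
  · intro n
    have : IntegrableOn (fun t : ℝ => (((-1)^(n+1) * (t^n/((n:ℝ)+1)) : ℝ) : ℂ)) (Ioc 0 1) := by
      refine Continuous.integrableOn_Ioc ?_
      fun_prop
    exact this.congr_fun (hfe n).symm measurableSet_Ioc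
  · have : ∀ n : ℕ, ∫ t in Ioc (0:ℝ) 1, ‖((-(t:ℂ))^(n+1) / ((n+1:ℕ):ℂ) / (t:ℂ))‖ = 1/((n+1:ℕ):ℝ)^2 := by
      intro n
      rw [setIntegral_congr_fun measurableSet_Ioc (hF n), hint]
      push_cast; rfl
    simp_rw [this]
    exact (summable_nat_add_iff (f := fun n : ℕ => 1/(n:ℝ)^2) 1).2 hasSum_zeta_two.summable

noncomputable def Lam (t : ℂ) : ℂ :=
  Real.pi*t^2/2 + Li2 (-Complex.exp (2*Real.pi*t))/(2*Real.pi) + Real.pi/24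

theorem Lam_deriv (t : ℂ) (ht : t ∈ St) :
    HasDerivAt Lam (Real.pi*t - Complex.log (1 + Complex.exp (2*Real.pi*t))) t := by
  have h1 : HasDerivAt (fun t : ℂ => Real.pi*t^2/2) (Real.pi*t) t := by
    refine (((hasDerivAt_pow 2 t).const_mul (Real.pi:ℂ)).div_const 2).congr_deriv ?_
    simp; ring
  have hp : (Real.pi:ℂ) ≠ 0 := by exact_mod_cast Real.pi_ne_zero
  have he := Complex.exp_ne_zero (2*Real.pi*t)
  have h2 := (Li2_deriv (-Complex.exp (2*Real.pi*t)) (by simpa using slit_mem t ht) (by simpa using he)).comp t (exp2_deriv t).neg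
  refine ((h1.add (h2.div_const (2*Real.pi))).add_const _).congr_deriv ?_
  rw [sub_neg_eq_add]
  field_simp
  ring

theorem P0_val (t : ℂ) (ht : t ∈ St) : P0 t + t * ((-Real.log 2 : ℝ):ℂ) = Lam t := by
  refine St_eq (fun t => P0 t + t * ((-Real.log 2 : ℝ):ℂ)) Lam _ ?_ Lam_deriv ?_ t ht
  · intro t ht
    have := (P0_deriv t ht).add ((hasDerivAt_id t).mul_const ((-Real.log 2 : ℝ):ℂ))
    refine this.congr_deriv ?_
    rw [P1_val t ht]
    push_cast
    ring
  · have : P0 0 = 0 := by simp [P0, p0]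
    have hp : (Real.pi:ℂ) ≠ 0 := by exact_mod_cast Real.pi_ne_zero
    simp [this, Lam, Li2_neg_one]
    field_simp
    ring

theorem Lb_eq {b : ℝ} (hb : 0 < b) (t : ℂ) (ht : t ∈ St) :
    Lb b (t / b) = Complex.I/(b:ℂ)^2 * (Lam t + Eb (b^2) t) := by
  rw [Lb_decomp hb t ht, kap_val, P0_val t ht]


theorem int_exp_abs {k : ℝ} (hk : 0 < k) : Integrable (fun x : ℝ => Real.exp (-(k*|x|))) := by
  rw [← integrableOn_univ, ← Iic_union_Ioi (a := (0:ℝ))]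
  refine IntegrableOn.union ?_ ?_
  · refine (integrableOn_exp_mul_Iic hk 0).congr_fun (fun x hx => ?_) measurableSet_Iic
    simp only
    rw [abs_of_nonpos hx]; ring_nf
  · refine (integrableOn_exp_mul_Ioi (neg_lt_zero.2 hk) 0).congr_fun (fun x hx => ?_) measurableSet_Ioi
    simp only
    rw [abs_of_pos hx]; ring_nf

theorem exp_diff_le (x y : ℂ) (M : ℝ) (hx : x.re ≤ M) (hy : y.re ≤ M) :
    ‖Complex.exp x - Complex.exp y‖ ≤ Real.exp M * ‖x - y‖ := by
  refine Convex.norm_image_sub_le_of_norm_hasDerivWithin_le (s := {z : ℂ | z.re ≤ M}) (f' := Complex.exp)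
    (fun z hz => (Complex.hasDerivAt_exp z).hasDerivWithinAt) (fun z hz => ?_)
    (convex_halfSpace_re_le M) hy hx
  rw [Complex.norm_exp]
  exact Real.exp_le_exp.2 hz

theorem tangent_le {g g' : ℝ → ℝ} {D : Set ℝ} (hD : D.OrdConnected)
    (hg : ∀ x ∈ D, HasDerivAt g (g' x) x) (ha : AntitoneOn g' D) {x y : ℝ} (hx : x ∈ D) (hy : y ∈ D) :
    g y ≤ g x + g' x * (y - x) := by
  rcases lt_trichotomy x y with h | h | h
  · have hs : Icc x y ⊆ D := hD.out hx hy
    obtain ⟨c, hc, he⟩ := exists_hasDerivAt_eq_slope g g' h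
      (fun z hz => (hg z (hs hz)).continuousAt.continuousWithinAt)
      (fun z hz => hg z (hs (Ioo_subset_Icc_self hz)))
    have h1 := ha hx (hs (Ioo_subset_Icc_self hc)) hc.1.le
    have h2 : 0 < y - x := sub_pos.2 h
    rw [he, div_le_iff₀ h2] at h1
    linarith
  · subst h; simp
  · have hs : Icc y x ⊆ D := hD.out hy hx
    obtain ⟨c, hc, he⟩ := exists_hasDerivAt_eq_slope g g' h
      (fun z hz => (hg z (hs hz)).continuousAt.continuousWithinAt)
      (fun z hz => hg z (hs (Ioo_subset_Icc_self hz)))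
    have h1 := ha (hs (Ioo_subset_Icc_self hc)) hx hc.2.le
    have h2 : 0 < x - y := sub_pos.2 h
    rw [he, le_div_iff₀ h2] at h1
    linarith

theorem anti_of {g' g'' : ℝ → ℝ} {D : Set ℝ} (hD : Convex ℝ D)
    (hg : ∀ x ∈ D, HasDerivAt g' (g'' x) x) (hn : ∀ x ∈ D, g'' x ≤ 0) : AntitoneOn g' D := by
  refine antitoneOn_of_deriv_nonpos hD (fun x hx => (hg x hx).continuousAt.continuousWithinAt)
    (fun x hx => (hg x (interior_subset hx)).differentiableAt.differentiableWithinAt) (fun x hx => ?_)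
  rw [(hg x (interior_subset hx)).deriv]
  exact hn x (interior_subset hx)

theorem concave_quad {g g' g'' : ℝ → ℝ} {m : ℝ} (hg : ∀ x, HasDerivAt g (g' x) x)
    (hg' : ∀ x, HasDerivAt g' (g'' x) x) (hn : ∀ x, g'' x ≤ 0)
    (hm : ∀ x ∈ Icc (-1:ℝ) 1, g'' x ≤ -m) (h0 : g 0 = 0) (h0' : g' 0 = 0) :
    (∀ s, |s| ≤ 1 → g s ≤ -(m*s^2/2)) ∧ (∀ s, 1 ≤ |s| → g s ≤ -(m*|s|/2)) := by
  have A : ∀ s, |s| ≤ 1 → g s ≤ -(m*s^2/2) := by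
    intro s hs
    have hq : ∀ x : ℝ, HasDerivAt (fun x : ℝ => m*x^2/2) (m*x) x := by
      intro x
      refine (((hasDerivAt_pow 2 x).const_mul m).div_const 2).congr_deriv ?_
      simp; ring
    have hq' : ∀ x : ℝ, HasDerivAt (fun x : ℝ => m*x) m x := by
      intro x; simpa using (hasDerivAt_id x).const_mul m
    have := tangent_le (g := fun x => g x + m*x^2/2) (g' := fun x => g' x + m*x) (D := Icc (-1) 1)
      ordConnected_Icc (fun x _ => (hg x).add (hq x))
      (anti_of (g'' := fun x => g'' x + m) (convex_Icc _ _) (fun x _ => (hg' x).add (hq' x))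
        (fun x hx => by linarith [hm x hx])) (x := 0) (y := s) (by simp) (abs_le.1 hs)
    simp [h0, h0'] at this
    linarith
  refine ⟨A, fun s hs => ?_⟩
  have anti : AntitoneOn g' univ := anti_of convex_univ (fun x _ => hg' x) (fun x _ => hn x)
  have hpos : 0 < |s| := by linarith
  set e := s / |s| with he
  have e1 : |e| = 1 := by rw [he, abs_div, abs_abs, div_self hpos.ne']
  have t1 := tangent_le ordConnected_univ (fun x _ => hg x) anti (x := e) (y := s) trivial trivial
  have t2 := tangent_le ordConnected_univ (fun x _ => hg x) anti (x := e) (y := 0) trivial trivial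
  have hA := A e e1.le
  have e2 : e^2 = 1 := by rw [← sq_abs, e1, one_pow]
  have hs2 : s = |s| * e := by rw [he]; field_simp
  rw [h0] at t2
  rw [e2] at hA
  have : g s ≤ |s| * g e := by
    have : s - e = (|s| - 1) * e := by linear_combination hs2
    rw [this] at t1
    nlinarith
  nlinarith

theorem pow_int_bound {f f' : ℝ → ℂ} {K : ℝ} (hK : 0 ≤ K) (n : ℕ) (hf : ∀ x, HasDerivAt f (f' x) x)
    (h0 : f 0 = 0) (hb : ∀ x, ‖f' x‖ ≤ K*|x|^n) (s : ℝ) : ‖f s‖ ≤ K*|s|^(n+1) := by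
  have := Convex.norm_image_sub_le_of_norm_hasDerivWithin_le (s := Icc (-|s|) |s|) (f := f) (f' := f')
    (C := K*|s|^n) (fun x _ => (hf x).hasDerivWithinAt) (fun x hx => (hb x).trans ?_) (convex_Icc _ _)
    (x := 0) (y := s) (by simp) (abs_le.1 le_rfl)
  · simpa [h0, pow_succ, mul_assoc] using this
  · have : |x| ≤ |s| := abs_le.2 hx
    gcongr

theorem shift_contour {f : ℂ → ℂ} {v1 v2 K k : ℝ} (hk : 0 < k)
    (hd : ∀ z : ℂ, z.im ∈ Icc v1 v2 → DifferentiableAt ℂ f z)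
    (hb : ∀ u : ℝ, ∀ v ∈ Icc v1 v2, ‖f (u + v * Complex.I)‖ ≤ K * Real.exp (-(k*|u|)))
    {v w : ℝ} (hv : v ∈ Icc v1 v2) (hw : w ∈ Icc v1 v2) :
    Integrable (fun u : ℝ => f (u + v * Complex.I)) ∧
    ∫ u : ℝ, f (u + v * Complex.I) = ∫ u : ℝ, f (u + w * Complex.I) := by
  have hint : ∀ v ∈ Icc v1 v2, Integrable (fun u : ℝ => f (u + v * Complex.I)) := by
    intro v hv
    refine Integrable.mono' ((int_exp_abs hk).const_mul K) ?_ (Eventually.of_forall fun u => hb u v hv)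
    refine Continuous.aestronglyMeasurable ?_
    rw [continuous_iff_continuousAt]
    intro u
    refine ContinuousAt.comp (f := fun u : ℝ => (u + v * Complex.I : ℂ)) (hd _ (by simpa using hv)).continuousAt (by fun_prop)
  refine ⟨hint v hv, ?_⟩
  have hsub : uIcc v w ⊆ Icc v1 v2 := uIcc_subset_Icc hv hw
  have hrect : ∀ T : ℝ, (∫ u in (-T)..T, f (u + v * Complex.I)) - (∫ u in (-T)..T, f (u + w * Complex.I))
      = Complex.I * (∫ y in v..w, f ((-T:ℝ) + y * Complex.I)) - Complex.I * (∫ y in v..w, f (T + y * Complex.I)) := by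
    intro T
    have := Complex.integral_boundary_rect_eq_zero_of_differentiableOn f ((-T:ℝ) + v * Complex.I)
      (T + w * Complex.I) (fun z hz => by
        refine (hd z (hsub ?_)).differentiableWithinAt
        have := hz.2
        simpa using this)
    simp only [Complex.add_re, Complex.add_im, Complex.ofReal_re, Complex.ofReal_im, Complex.mul_re, Complex.mul_im,
      Complex.I_re, Complex.I_im, mul_zero, mul_one, sub_zero, add_zero, zero_add, smul_eq_mul] at this
    linear_combination this
  have lim0 : Tendsto (fun T : ℝ => K * Real.exp (-(k*T)) * |w - v|) atTop (𝓝 0) := by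
    have : Tendsto (fun T : ℝ => Real.exp (-(k*T))) atTop (𝓝 0) :=
      Real.tendsto_exp_neg_atTop_nhds_zero.comp (tendsto_id.const_mul_atTop hk)
    simpa using (this.const_mul K).mul_const |w-v|
  have limv : ∀ ε : ℝ, |ε| = 1 → Tendsto (fun T : ℝ => ∫ y in v..w, f ((ε*T:ℝ) + y * Complex.I)) atTop (𝓝 0) := by
    intro ε hε
    refine squeeze_zero_norm' ?_ lim0
    filter_upwards [eventually_ge_atTop 0] with T hT
    refine intervalIntegral.norm_integral_le_of_norm_le_const fun y hy => ?_
    refine (hb _ y (hsub (uIoc_subset_uIcc hy))).trans ?_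
    rw [abs_mul, hε, one_mul, abs_of_nonneg hT]
  have l1 := limv (-1) (by simp)
  have l2 := limv 1 (by simp)
  simp only [one_mul, neg_mul] at l1 l2
  have L1 := (intervalIntegral_tendsto_integral (hint v hv) tendsto_neg_atTop_atBot tendsto_id).sub
    (intervalIntegral_tendsto_integral (hint w hw) tendsto_neg_atTop_atBot tendsto_id)
  have L2 := (l1.const_mul Complex.I).sub (l2.const_mul Complex.I)
  have := tendsto_nhds_unique (L1.congr fun T => hrect T) L2
  simp only [mul_zero, sub_zero] at this
  exact sub_eq_zero.1 this

theorem laplace {φ : ℝ → ℂ} {a : ℂ} {m K : ℝ} (hm : 0 < m) (hK : 0 < K) (ha : m ≤ a.re)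
    (hφc : Continuous φ)
    (h1 : ∀ s, |s| ≤ 1 → (φ s).re ≤ -(m*s^2/2)) (h2 : ∀ s, 1 ≤ |s| → (φ s).re ≤ -(m*|s|/2))
    (h3 : ∀ s, ‖φ s + a*s^2/2‖ ≤ K*|s|^3) :
    ∃ C > 0, ∃ b₀ ∈ Ioo (0:ℝ) 1, ∀ b ∈ Ioo (0:ℝ) b₀, ∀ E : ℝ → ℂ, Continuous E →
      (∀ s, ‖E s‖ ≤ K*(b+|s|)) →
      ‖(∫ y : ℝ, Complex.exp (φ (b*y)/(b:ℂ)^2 + E (b*y))) - (2*Real.pi/a)^(1/2:ℂ)‖ ≤ C*b := by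
  set B : ℝ → ℝ := fun y => Real.exp (m/2 + K) * (K*(1+|y|+|y|^3)) * Real.exp (-(m/4*|y|)) with hB
  have hBint : Integrable B := by
    set c := m/8
    have hc : 0 < c := by positivity
    refine Integrable.mono' ((int_exp_abs hc).const_mul (Real.exp (m/2+K) * (K*(1+1/c+6/c^3)))) ?_ ?_
    · refine Continuous.aestronglyMeasurable ?_
      fun_prop
    · refine Eventually.of_forall fun y => ?_
      rw [hB, Real.norm_of_nonneg (by positivity)]
      have hy : 0 ≤ c*|y| := by positivity
      have e0 : 1 ≤ Real.exp (c*|y|) := Real.one_le_exp hy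
      have e1 : c*|y| ≤ Real.exp (c*|y|) := by linarith [Real.add_one_le_exp (c*|y|)]
      have e3 : (c*|y|)^3/6 ≤ Real.exp (c*|y|) := by
        have := Real.pow_div_factorial_le_exp (c*|y|) hy 3
        simpa [Nat.factorial] using this
      have e4 : 1+|y|+|y|^3 ≤ (1+1/c+6/c^3) * Real.exp (c*|y|) := by
        have : |y| = 1/c*(c*|y|) := by field_simp
        have h5 : |y| ≤ 1/c * Real.exp (c*|y|) := by
          calc |y| = 1/c*(c*|y|) := this
            _ ≤ _ := by gcongr
        have h6 : |y|^3 ≤ 6/c^3 * Real.exp (c*|y|) := by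
          calc |y|^3 = 6/c^3*((c*|y|)^3/6) := by field_simp
            _ ≤ _ := by gcongr
        linarith
      have e5 : Real.exp (-(m/4*|y|)) = Real.exp (-(c*|y|)) * Real.exp (-(c*|y|)) := by
        rw [← Real.exp_add]; congr 1; simp only [c]; ring
      calc Real.exp (m/2 + K) * (K*(1+|y|+|y|^3)) * Real.exp (-(m/4*|y|)) ≤ Real.exp (m/2+K) * (K*((1+1/c+6/c^3) * Real.exp (c*|y|))) * Real.exp (-(m/4*|y|)) := by gcongr
        _ = Real.exp (m/2+K) * (K*(1+1/c+6/c^3)) * (Real.exp (c*|y|) * Real.exp (-(c*|y|))) * Real.exp (-(c*|y|)) := by rw [e5]; ring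
        _ = _ := by rw [← Real.exp_add]; simp
  have hare : 0 < (a/2).re := by
    have : (a/2).re = a.re/2 := by simp
    rw [this]; linarith
  have hG := integral_gaussian_complex hare
  have hGi := integrable_cexp_neg_mul_sq hare
  have hpi2 : (2*Real.pi/a : ℂ) = Real.pi/(a/2) := by
    field_simp
  rw [hpi2, ← hG]
  have hyy : ∀ y : ℝ, -(m*y^2/2) ≤ m/2 - m/2*|y| := by
    intro y
    have : 0 ≤ (|y|-1)^2 := sq_nonneg _
    have h5 : y^2 = |y|^2 := (sq_abs y).symm
    have : |y| ≤ y^2 + 1 := by nlinarith [abs_nonneg y]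
    nlinarith
  refine ⟨(∫ y, B y) + 1, ?_, min (1/2) (m/(4*K)), ⟨by positivity, (min_le_left _ _).trans_lt (by norm_num)⟩, ?_⟩
  · have : 0 ≤ ∫ y, B y := integral_nonneg fun y => by positivity
    linarith
  intro b hb E hE hEb
  have hb0 : 0 < b := hb.1
  have hb1 : b < 1 := by
    have := hb.2.trans_le (min_le_left _ _); linarith
  have hbK : K*b ≤ m/4 := by
    have := hb.2.trans_le (min_le_right _ _)
    rw [lt_div_iff₀ (by positivity)] at this
    linarith
  have hbC : (b:ℂ) ≠ 0 := by exact_mod_cast hb0.ne'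
  have hre1 : ∀ y : ℝ, (φ (b*y)/(b:ℂ)^2).re ≤ m/2 - m/2*|y| := by
    intro y
    have e : (φ (b*y)/(b:ℂ)^2).re = (φ (b*y)).re/b^2 := by
      rw [← Complex.ofReal_pow, Complex.div_ofReal_re]
    rw [e, div_le_iff₀ (by positivity)]
    rcases le_total |b*y| 1 with h | h
    · refine (h1 _ h).trans ?_
      have := hyy y
      nlinarith [sq_nonneg b]
    · refine (h2 _ h).trans ?_
      rw [abs_mul, abs_of_pos hb0]
      have : b^2*|y| ≤ b*|y| := by
        have := abs_nonneg y
        nlinarith [mul_nonneg hb0.le this]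
      nlinarith [sq_nonneg b]
  have hE2 : ∀ y, ‖E (b*y)‖ ≤ K*b*(1+|y|) := by
    intro y
    refine (hEb _).trans (le_of_eq ?_)
    rw [abs_mul, abs_of_pos hb0]; ring
  have hre : ∀ y : ℝ, (φ (b*y)/(b:ℂ)^2 + E (b*y)).re ≤ m/2 + K - m/4*|y| := by
    intro y
    rw [Complex.add_re]
    have h5 := (Complex.re_le_norm _).trans (hE2 y)
    have h6 := hre1 y
    have h7 : K*b ≤ K := by nlinarith
    have h8 : K*b*|y| ≤ m/4*|y| := by gcongr
    nlinarith
  have hre' : ∀ y : ℝ, (-(a/2)*(y:ℂ)^2).re ≤ m/2 + K - m/4*|y| := by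
    intro y
    have : (-(a/2)*(y:ℂ)^2).re = -(a.re*y^2/2) := by
      rw [← Complex.ofReal_pow, Complex.re_mul_ofReal]; simp; ring
    rw [this]
    have h5 := hyy y
    nlinarith [sq_nonneg y, abs_nonneg y]
  have hd : ∀ y : ℝ, ‖Complex.exp (φ (b*y)/(b:ℂ)^2 + E (b*y)) - Complex.exp (-(a/2)*(y:ℂ)^2)‖ ≤ b * B y := by
    intro y
    refine (exp_diff_le _ _ _ (hre y) (hre' y)).trans ?_
    have h5 : ‖φ (b*y)/(b:ℂ)^2 + E (b*y) - (-(a/2)*(y:ℂ)^2)‖ ≤ b*(K*(1+|y|+|y|^3)) := by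
      have e : φ (b*y)/(b:ℂ)^2 + E (b*y) - (-(a/2)*(y:ℂ)^2)
          = (φ (b*y) + a*((b*y:ℝ):ℂ)^2/2)/(b:ℂ)^2 + E (b*y) := by
        push_cast; field_simp; ring
      rw [e]
      refine (norm_add_le _ _).trans ?_
      have h6 : ‖(φ (b*y) + a*((b*y:ℝ):ℂ)^2/2)/(b:ℂ)^2‖ ≤ K*b*|y|^3 := by
        rw [norm_div, norm_pow, Complex.norm_real, Real.norm_of_nonneg hb0.le, div_le_iff₀ (by positivity)]
        refine (h3 (b*y)).trans (le_of_eq ?_)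
        rw [abs_mul, abs_of_pos hb0]; ring
      linarith [hE2 y]
    calc _ ≤ Real.exp (m/2+K-m/4*|y|) * (b*(K*(1+|y|+|y|^3))) := by gcongr
      _ = b * B y := by
        simp only [hB]
        rw [sub_eq_add_neg, Real.exp_add]; ring
  have hint : Integrable (fun y : ℝ => Complex.exp (φ (b*y)/(b:ℂ)^2 + E (b*y))) := by
    refine Integrable.mono' ((int_exp_abs (k := m/4) (by positivity)).const_mul (Real.exp (m/2+K))) ?_ ?_
    · refine Continuous.aestronglyMeasurable ?_
      fun_prop
    · refine Eventually.of_forall fun y => ?_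
      rw [Complex.norm_exp, ← Real.exp_add]
      refine Real.exp_le_exp.2 ((hre y).trans (le_of_eq (by ring)))
  rw [← integral_sub hint hGi]
  refine (norm_integral_le_of_norm_le (hBint.const_mul b) (Eventually.of_forall hd)).trans ?_
  rw [integral_const_mul]
  nlinarith


noncomputable def Lf (t : ℂ) : ℂ := Complex.log (1 + Complex.exp (2*Real.pi*t))
noncomputable def Wf (t : ℂ) : ℂ := Complex.exp (2*Real.pi*t) / (1 + Complex.exp (2*Real.pi*t))
noncomputable def Wd (t : ℂ) : ℂ := Complex.exp (2*Real.pi*t) / (1 + Complex.exp (2*Real.pi*t))^2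
noncomputable def Fp (σ μ : ℝ) (t : ℂ) : ℂ :=
  -(Complex.I*Real.pi*t^2) + 2*Real.pi*Complex.I*μ*t + Real.pi*t
    + Complex.I*Lam (t+σ) + Complex.I*Lam (t-σ)
noncomputable def F1 (σ μ : ℝ) (t : ℂ) : ℂ :=
  2*Real.pi*Complex.I*μ + Real.pi - Complex.I*Lf (t+σ) - Complex.I*Lf (t-σ)
noncomputable def F2 (σ : ℝ) (t : ℂ) : ℂ := -(Complex.I*(2*Real.pi)*(Wf (t+σ) + Wf (t-σ)))
noncomputable def F3 (σ : ℝ) (t : ℂ) : ℂ := -(Complex.I*(2*Real.pi)*(2*Real.pi)*(Wd (t+σ) + Wd (t-σ)))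

theorem St_add {t : ℂ} (ht : t ∈ St) (σ : ℝ) : t + σ ∈ St := by
  have : |t.im| < 1/2 := ht
  show |(t+σ).im| < 1/2
  simpa using this

theorem St_sub {t : ℂ} (ht : t ∈ St) (σ : ℝ) : t - σ ∈ St := by
  have : |t.im| < 1/2 := ht
  show |(t-σ).im| < 1/2
  simpa using this

theorem Lf_deriv (t : ℂ) (ht : t ∈ St) : HasDerivAt Lf (2*Real.pi*Wf t) t :=
  (logf_deriv t ht).congr_deriv (by rw [Wf]; ring)

theorem Wf_deriv (t : ℂ) (ht : t ∈ St) : HasDerivAt Wf (2*Real.pi*Wd t) t := by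
  have h := (exp2_deriv t).div ((exp2_deriv t).const_add 1) (Complex.slitPlane_ne_zero (slit_mem t ht))
  refine h.congr_deriv ?_
  rw [Wd]
  have := (Complex.slitPlane_ne_zero (slit_mem t ht))
  field_simp
  ring

theorem Fp_deriv (σ μ : ℝ) (t : ℂ) (ht : t ∈ St) : HasDerivAt (Fp σ μ) (F1 σ μ t) t := by
  have h1 : HasDerivAt (fun t : ℂ => Complex.I*Real.pi*t^2) (Complex.I*Real.pi*(2*t)) t := by
    refine ((hasDerivAt_pow 2 t).const_mul (Complex.I*Real.pi:ℂ)).congr_deriv ?_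
    simp
  have h2 : HasDerivAt (fun t : ℂ => 2*Real.pi*Complex.I*μ*t) (2*Real.pi*Complex.I*μ) t := by
    simpa using (hasDerivAt_id t).const_mul (2*Real.pi*Complex.I*μ : ℂ)
  have h3 : HasDerivAt (fun t : ℂ => Real.pi*t) (Real.pi:ℂ) t := by
    simpa using (hasDerivAt_id t).const_mul (Real.pi : ℂ)
  have h4 := ((Lam_deriv _ (St_add ht σ)).comp_add_const t (σ:ℂ)).const_mul Complex.I
  have h5 := ((Lam_deriv _ (St_sub ht σ)).comp_sub_const t (σ:ℂ)).const_mul Complex.I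
  refine ((((h1.neg.add h2).add h3).add h4).add h5).congr_deriv ?_
  rw [F1, Lf, Lf]
  ring

theorem F1_deriv (σ μ : ℝ) (t : ℂ) (ht : t ∈ St) : HasDerivAt (F1 σ μ) (F2 σ t) t := by
  have h4 := ((Lf_deriv _ (St_add ht σ)).comp_add_const t (σ:ℂ)).const_mul Complex.I
  have h5 := ((Lf_deriv _ (St_sub ht σ)).comp_sub_const t (σ:ℂ)).const_mul Complex.I
  refine ((h4.const_sub (2*Real.pi*Complex.I*μ + Real.pi)).sub h5).congr_deriv ?_
  rw [F2]; ring

theorem F2_deriv (σ : ℝ) (t : ℂ) (ht : t ∈ St) : HasDerivAt (F2 σ) (F3 σ t) t := by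
  have h4 := ((Wf_deriv _ (St_add ht σ)).comp_add_const t (σ:ℂ))
  have h5 := ((Wf_deriv _ (St_sub ht σ)).comp_sub_const t (σ:ℂ))
  refine ((h4.add h5).const_mul (Complex.I*(2*Real.pi))).neg.congr_deriv ?_
  rw [F3]; ring

theorem Wf_im_neg (t : ℂ) (h1 : -(1/2) < t.im) (h2 : t.im < 0) : (Wf t).im < 0 := by
  have ht : t ∈ St := by
    show |t.im| < 1/2
    rw [abs_lt]; constructor <;> linarith
  have hne := Complex.slitPlane_ne_zero (slit_mem t ht)
  have hn : 0 < Complex.normSq (1 + Complex.exp (2*Real.pi*t)) := Complex.normSq_pos.2 hne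
  have him : (Complex.exp (2*Real.pi*t)).im < 0 := by
    rw [Complex.exp_im]
    have : (2*Real.pi*t : ℂ).im = 2*Real.pi*t.im := by simp
    rw [this]
    refine mul_neg_of_pos_of_neg (Real.exp_pos _) (Real.sin_neg_of_neg_of_neg_pi_lt ?_ ?_)
    · nlinarith [Real.pi_pos]
    · nlinarith [Real.pi_pos]
  rw [Wf, Complex.div_im, ← sub_div, div_lt_iff₀ hn]
  simp only [Complex.add_re, Complex.add_im, Complex.one_re, Complex.one_im]
  linarith

theorem Wd_bound (t : ℂ) (ht : t ∈ St) : ‖Wd t‖ ≤ 1/(2*(1+Real.cos (2*Real.pi*t.im))) := by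
  have ht' : |t.im| < 1/2 := ht
  rw [abs_lt] at ht'
  have hpi := Real.pi_pos
  have hc : -1 < Real.cos (2*Real.pi*t.im) := by
    have : Real.cos Real.pi < Real.cos |2*Real.pi*t.im| := by
      refine Real.cos_lt_cos_of_nonneg_of_le_pi (abs_nonneg _) le_rfl ?_
      rw [abs_lt]; constructor <;> nlinarith
    rwa [Real.cos_pi, Real.cos_abs] at this
  have hne := Complex.slitPlane_ne_zero (slit_mem t ht)
  have hn : 0 < ‖1 + Complex.exp (2*Real.pi*t)‖ := norm_pos_iff.2 hne
  have him : (2*Real.pi*t : ℂ).im = 2*Real.pi*t.im := by simp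
  rw [Wd, norm_div, norm_pow, div_le_div_iff₀ (by positivity) (by linarith), one_mul]
  rw [← Complex.normSq_eq_norm_sq, Complex.normSq_apply]
  simp only [Complex.add_re, Complex.add_im, Complex.one_re, Complex.one_im, Complex.exp_re, Complex.exp_im,
    Complex.norm_exp, him]
  set R := Real.exp (2*Real.pi*t : ℂ).re
  set θ := 2*Real.pi*t.im
  have e : (1 + R * Real.cos θ) * (1 + R * Real.cos θ) + (0 + R * Real.sin θ) * (0 + R * Real.sin θ)
      = 1 + 2*R*Real.cos θ + R^2 := by
    linear_combination R^2 * Real.sin_sq_add_cos_sq θ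
  rw [e]
  nlinarith [sq_nonneg (R-1)]

theorem St_neg {t : ℂ} (ht : t ∈ St) : -t ∈ St := by
  have : |t.im| < 1/2 := ht
  show |(-t).im| < 1/2
  simpa using this

theorem Lf_refl (t : ℂ) (ht : t ∈ St) : Lf t = 2*Real.pi*t + Lf (-t) := by
  refine St_eq Lf (fun t => 2*Real.pi*t + Lf (-t)) _ Lf_deriv ?_ ?_ t ht
  · intro t ht
    have h2 : HasDerivAt (fun t : ℂ => 2*Real.pi*t) (2*Real.pi) t := by
      simpa using (hasDerivAt_id t).const_mul (2*Real.pi : ℂ)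
    have h3 := HasDerivAt.scomp t (Lf_deriv (-t) (St_neg ht)) (hasDerivAt_neg t)
    refine (h2.add h3).congr_deriv ?_
    have h5 := Complex.slitPlane_ne_zero (slit_mem t ht)
    have h7 := Complex.exp_ne_zero (2*Real.pi*t)
    simp only [Wf, mul_neg, Complex.exp_neg, smul_eq_mul]
    have h6 : 1 + (Complex.exp (2*Real.pi*t))⁻¹ ≠ 0 := by
      have := Complex.slitPlane_ne_zero (slit_mem (-t) (St_neg ht))
      rwa [mul_neg, Complex.exp_neg] at this
    have h8 : Complex.exp (2*Real.pi*t) + 1 ≠ 0 := by rwa [add_comm]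
    field_simp
    ring
  · simp

theorem Lf_small (t : ℂ) (h : Real.exp (2*Real.pi*t.re) ≤ 1/2) : |(Lf t).im| ≤ 3/2*Real.exp (2*Real.pi*t.re) := by
  have hn : ‖Complex.exp (2*Real.pi*t)‖ = Real.exp (2*Real.pi*t.re) := by
    rw [Complex.norm_exp]; simp
  refine (Complex.abs_im_le_norm _).trans ?_
  rw [← hn] at h ⊢
  exact Complex.norm_log_one_add_half_le_self h

theorem line_deriv {F : ℂ → ℂ} {d : ℂ} (t0 : ℂ) (s : ℝ) (h : HasDerivAt F d (t0 + s)) :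
    HasDerivAt (fun s : ℝ => F (t0 + s)) d s :=
  HasDerivAt.comp_ofReal (h.comp_const_add t0 (s:ℂ))

theorem re_deriv {f : ℝ → ℂ} {d : ℂ} {s : ℝ} (h : HasDerivAt f d s) : HasDerivAt (fun s => (f s).re) d.re s :=
  Complex.reCLM.hasFDerivAt.comp_hasDerivAt s h

theorem mem_St {t : ℂ} (h1 : -(1/2) < t.im) (h2 : t.im < 0) : t ∈ St := by
  show |t.im| < 1/2
  rw [abs_lt]; constructor <;> linarith

theorem F2_re_neg (σ : ℝ) (t : ℂ) (h1 : -(1/2) < t.im) (h2 : t.im < 0) : (F2 σ t).re < 0 := by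
  have e : (F2 σ t).re = 2*Real.pi*((Wf (t+σ)).im + (Wf (t-σ)).im) := by
    simp [F2]
  rw [e]
  have := Wf_im_neg (t+σ) (by simpa using h1) (by simpa using h2)
  have := Wf_im_neg (t-σ) (by simpa using h1) (by simpa using h2)
  nlinarith [Real.pi_pos]

theorem F1_re (σ μ : ℝ) (t : ℂ) : (F1 σ μ t).re = Real.pi + (Lf (t+σ)).im + (Lf (t-σ)).im := by
  simp [F1]

theorem decay (σ μ v1 v2 : ℝ) (h1 : -(1/2) < v1) (h12 : v1 ≤ v2) (h2 : v2 < -(1/4)) :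
    ∃ A : ℝ, ∃ k > 0, ∀ u : ℝ, ∀ v ∈ Icc v1 v2, (Fp σ μ (u + v*Complex.I)).re ≤ A - k*|u| := by
  have hpi := Real.pi_gt_three
  set k0 := -(Real.pi + 4*Real.pi*v2) with hk0
  have hk0p : 0 < k0 := by rw [hk0]; nlinarith
  have hk0l : k0 < Real.pi := by rw [hk0]; nlinarith
  set δ := min (1/6) (k0/6) with hδ
  have hδp : 0 < δ := by positivity
  have hδ1 : δ ≤ 1/6 := min_le_left _ _
  have hδ2 : δ ≤ k0/6 := min_le_right _ _
  obtain ⟨U, hU0, hU⟩ : ∃ U ≥ 0, Real.exp (2*Real.pi*(|σ| - U)) ≤ δ := by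
    refine ⟨|σ| + |Real.log δ|, by positivity, ?_⟩
    rw [← Real.le_log_iff_exp_le hδp]
    have h3 := neg_abs_le (Real.log δ)
    have h4 := abs_nonneg (Real.log δ)
    nlinarith
  have small : ∀ t : ℂ, t.re ≤ |σ| - U → |(Lf t).im| ≤ 3/2*δ := by
    intro t ht
    have h3 : Real.exp (2*Real.pi*t.re) ≤ δ := by
      refine le_trans (Real.exp_le_exp.2 ?_) hU
      nlinarith
    refine (Lf_small t (by linarith)).trans (by linarith)
  have hσ1 := le_abs_self σ
  have hσ2 := neg_abs_le σ
  have hSt : ∀ (u : ℝ) v, v ∈ Icc v1 v2 → (u + v*Complex.I : ℂ) ∈ St := fun u v hv =>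
    mem_St (by simp; linarith [hv.1]) (by simp; linarith [hv.2])
  have hL : ∀ v ∈ Icc v1 v2, k0/2 ≤ (F1 σ μ ((-U:ℝ) + v*Complex.I)).re := by
    intro v hv
    rw [F1_re]
    have a1 := small ((-U:ℝ) + v*Complex.I + σ) (by simp; linarith)
    have a2 := small ((-U:ℝ) + v*Complex.I - σ) (by simp; linarith)
    rw [abs_le] at a1 a2
    linarith
  have hR : ∀ v ∈ Icc v1 v2, (F1 σ μ ((U:ℝ) + v*Complex.I)).re ≤ -(k0/2) := by
    intro v hv
    rw [F1_re, Lf_refl _ (St_add (hSt U v hv) σ), Lf_refl _ (St_sub (hSt U v hv) σ)]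
    have a1 := small (-((U:ℝ) + v*Complex.I + σ)) (by simp; linarith)
    have a2 := small (-((U:ℝ) + v*Complex.I - σ)) (by simp; linarith)
    rw [abs_le] at a1 a2
    have e1 : (2*Real.pi*((U:ℝ) + v*Complex.I + σ) : ℂ).im = 2*Real.pi*v := by simp
    have e2 : (2*Real.pi*((U:ℝ) + v*Complex.I - σ) : ℂ).im = 2*Real.pi*v := by simp
    rw [Complex.add_im, Complex.add_im, e1, e2]
    have := hv.2
    nlinarith
  obtain ⟨A, hA⟩ : ∃ A, ∀ p ∈ (Icc (-U) U) ×ˢ (Icc v1 v2), ‖Fp σ μ (p.1 + p.2*Complex.I)‖ ≤ A := by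
    refine (isCompact_Icc.prod isCompact_Icc).exists_bound_of_continuousOn ?_
    rintro ⟨u, v⟩ ⟨hu, hv⟩
    refine ContinuousAt.continuousWithinAt ?_
    have hc : Continuous (fun p : ℝ × ℝ => (p.1 + p.2*Complex.I : ℂ)) := by fun_prop
    exact ContinuousAt.comp (x := (u, v)) (f := fun p : ℝ × ℝ => (p.1 + p.2*Complex.I : ℂ)) (g := Fp σ μ)
      (Fp_deriv σ μ _ (hSt u v hv)).continuousAt hc.continuousAt
  refine ⟨A + k0/2*U, k0/2, by positivity, fun u v hv => ?_⟩
  have hd : ∀ x ∈ (univ : Set ℝ), HasDerivAt (fun x : ℝ => (Fp σ μ (x + v*Complex.I)).re) (F1 σ μ (x + v*Complex.I)).re x := by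
    intro x _
    have h3 := re_deriv (line_deriv (v*Complex.I) x (Fp_deriv σ μ _ (by rw [add_comm]; exact hSt x v hv)))
    simpa only [add_comm] using h3
  have hd' : ∀ x ∈ (univ : Set ℝ), HasDerivAt (fun x : ℝ => (F1 σ μ (x + v*Complex.I)).re) (F2 σ (x + v*Complex.I)).re x := by
    intro x _
    have h3 := re_deriv (line_deriv (v*Complex.I) x (F1_deriv σ μ _ (by rw [add_comm]; exact hSt x v hv)))
    simpa only [add_comm] using h3
  have anti := anti_of convex_univ hd' (fun x _ => (F2_re_neg σ _ (by simp; linarith [hv.1]) (by simp; linarith [hv.2])).le)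
  have hUm : ∀ x ∈ Icc (-U) U, (Fp σ μ (x + v*Complex.I)).re ≤ A := fun x hx =>
    (Complex.re_le_norm _).trans (hA (x, v) ⟨hx, hv⟩)
  rcases le_total |u| U with h | h
  · have := hUm u (abs_le.1 h)
    nlinarith
  · rcases le_total 0 u with h0 | h0
    · rw [abs_of_nonneg h0] at h ⊢
      have := tangent_le ordConnected_univ hd anti (x := U) (y := u) trivial trivial
      have h5 := hUm U ⟨by linarith, le_rfl⟩
      have h6 := hR v hv
      nlinarith
    · rw [abs_of_nonpos h0] at h ⊢
      have := tangent_le ordConnected_univ hd anti (x := -U) (y := u) trivial trivial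
      have h5 := hUm (-U) ⟨le_rfl, by linarith⟩
      have h6 := hL v hv
      nlinarith


noncomputable def rr (σ μ : ℝ) : ℝ := Real.sqrt (Real.exp (2*Real.pi*μ) - Real.sinh (2*Real.pi*σ)^2)
noncomputable def XX (σ μ : ℝ) : ℂ := -(Real.cosh (2*Real.pi*σ) : ℂ) - Complex.I * (rr σ μ : ℂ)
noncomputable def ts (σ μ : ℝ) : ℂ := Complex.log (XX σ μ) / (2*Real.pi)

theorem rr_pos (σ μ : ℝ) (h : Real.sinh (2*Real.pi*σ)^2 < Real.exp (2*Real.pi*μ)) : 0 < rr σ μ :=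
  Real.sqrt_pos.2 (by linarith)

theorem rr_sq (σ μ : ℝ) (h : Real.sinh (2*Real.pi*σ)^2 < Real.exp (2*Real.pi*μ)) :
    rr σ μ ^2 = Real.exp (2*Real.pi*μ) - Real.sinh (2*Real.pi*σ)^2 :=
  Real.sq_sqrt (by linarith)

theorem XX_re (σ μ : ℝ) : (XX σ μ).re = -Real.cosh (2*Real.pi*σ) := by
  simp only [XX, Complex.sub_re, Complex.neg_re, Complex.ofReal_re, Complex.mul_re, Complex.I_re, Complex.I_im,
    Complex.ofReal_im]; ring
theorem XX_im (σ μ : ℝ) : (XX σ μ).im = -rr σ μ := by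
  simp only [XX, Complex.sub_im, Complex.neg_im, Complex.ofReal_re, Complex.mul_im, Complex.I_re, Complex.I_im,
    Complex.ofReal_im]; ring

theorem XX_ne (σ μ : ℝ) : XX σ μ ≠ 0 := by
  intro h0
  have := XX_re σ μ
  rw [h0] at this
  have := Real.cosh_pos (2*Real.pi*σ)
  simp at *
  linarith

theorem exp_ts (σ μ : ℝ) : Complex.exp (2*Real.pi*ts σ μ) = XX σ μ := by
  rw [ts, mul_div_cancel₀ _ (by simp), Complex.exp_log (XX_ne σ μ)]

theorem ts_im (σ μ : ℝ) : (ts σ μ).im = (XX σ μ).arg / (2*Real.pi) := by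
  rw [ts, show (2*Real.pi:ℂ) = ((2*Real.pi:ℝ):ℂ) by push_cast; rfl, Complex.div_ofReal_im, Complex.log_im]

theorem ts_lo (σ μ : ℝ) : -(1/2) < (ts σ μ).im := by
  rw [ts_im, lt_div_iff₀ (by positivity)]
  have := Complex.neg_pi_lt_arg (XX σ μ)
  linarith

theorem ts_hi (σ μ : ℝ) (h : Real.sinh (2*Real.pi*σ)^2 < Real.exp (2*Real.pi*μ)) : (ts σ μ).im < -(1/4) := by
  rw [ts_im, div_lt_iff₀ (by positivity)]
  have : ¬ (-(Real.pi/2) ≤ (XX σ μ).arg) := by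
    rw [Complex.neg_pi_div_two_le_arg_iff, XX_re, XX_im]
    have := Real.cosh_pos (2*Real.pi*σ)
    have := rr_pos σ μ h
    push Not
    constructor <;> linarith
  linarith

theorem exp_ts_add (σ μ : ℝ) : 1 + Complex.exp (2*Real.pi*(ts σ μ + σ)) =
    -((Real.exp (2*Real.pi*σ):ℂ) * ((Real.sinh (2*Real.pi*σ):ℂ) + Complex.I * rr σ μ)) := by
  rw [mul_add, Complex.exp_add, exp_ts, XX, Real.sinh_eq, Real.cosh_eq]
  have e1 : Complex.exp (2*Real.pi*σ) = ((Real.exp (2*Real.pi*σ):ℝ):ℂ) := by push_cast; rfl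
  have e2 : (Real.exp (-(2*Real.pi*σ)):ℂ) * (Real.exp (2*Real.pi*σ):ℂ) = 1 := by
    rw [← Complex.ofReal_mul, ← Real.exp_add]; simp
  rw [e1]
  push_cast at *
  linear_combination -e2

theorem exp_ts_sub (σ μ : ℝ) : 1 + Complex.exp (2*Real.pi*(ts σ μ - σ)) =
    ((Real.exp (-(2*Real.pi*σ)):ℂ) * ((Real.sinh (2*Real.pi*σ):ℂ) - Complex.I * rr σ μ)) := by
  rw [mul_sub, sub_eq_add_neg, Complex.exp_add, exp_ts, XX, Real.sinh_eq, Real.cosh_eq]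
  have e1 : Complex.exp (-(2*Real.pi*σ)) = ((Real.exp (-(2*Real.pi*σ)):ℝ):ℂ) := by push_cast; rfl
  have e2 : (Real.exp (-(2*Real.pi*σ)):ℂ) * (Real.exp (2*Real.pi*σ):ℂ) = 1 := by
    rw [← Complex.ofReal_mul, ← Real.exp_add]; simp
  rw [e1]
  push_cast at *
  linear_combination -e2

theorem r2_c (σ μ : ℝ) (h : Real.sinh (2*Real.pi*σ)^2 < Real.exp (2*Real.pi*μ)) :
    ((Real.sinh (2*Real.pi*σ):ℂ) + Complex.I * rr σ μ) * ((Real.sinh (2*Real.pi*σ):ℂ) - Complex.I * rr σ μ)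
      = (Real.exp (2*Real.pi*μ) : ℂ) := by
  have e := rr_sq σ μ h
  have e' : (rr σ μ : ℂ)^2 = (Real.exp (2*Real.pi*μ) : ℂ) - (Real.sinh (2*Real.pi*σ):ℂ)^2 := by
    exact_mod_cast e
  linear_combination e' - (rr σ μ:ℂ)^2 * Complex.I_sq

theorem saddle (σ μ : ℝ) (h : Real.sinh (2*Real.pi*σ)^2 < Real.exp (2*Real.pi*μ)) : F1 σ μ (ts σ μ) = 0 := by
  have hpi := Real.pi_pos
  have hr := rr_pos σ μ h
  have key : Lf (ts σ μ + σ) + Lf (ts σ μ - σ) = 2*Real.pi*μ - Complex.I*Real.pi := by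
    rw [Lf, Lf, exp_ts_add, exp_ts_sub]
    set A := -((Real.exp (2*Real.pi*σ):ℂ) * ((Real.sinh (2*Real.pi*σ):ℂ) + Complex.I * rr σ μ)) with hA
    set B := ((Real.exp (-(2*Real.pi*σ)):ℂ) * ((Real.sinh (2*Real.pi*σ):ℂ) - Complex.I * rr σ μ)) with hB
    have hAi : A.im < 0 := by
      have : A.im = -(Real.exp (2*Real.pi*σ) * rr σ μ) := by
        simp only [hA, Complex.neg_im, Complex.re_ofReal_mul, Complex.im_ofReal_mul, Complex.add_im, Complex.ofReal_im, Complex.mul_im, Complex.I_re, Complex.I_im, Complex.ofReal_re]; ring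
      rw [this]; have := Real.exp_pos (2*Real.pi*σ); nlinarith
    have hBi : B.im < 0 := by
      have : B.im = -(Real.exp (-(2*Real.pi*σ)) * rr σ μ) := by
        simp only [hB, Complex.im_ofReal_mul, Complex.sub_im, Complex.ofReal_im, Complex.mul_im, Complex.I_re, Complex.I_im, Complex.ofReal_re]; ring
      rw [this]; have := Real.exp_pos (-(2*Real.pi*σ)); nlinarith
    have hA0 : A ≠ 0 := by intro h0; rw [h0] at hAi; simp at hAi
    have hB0 : B ≠ 0 := by intro h0; rw [h0] at hBi; simp at hBi
    have hAB : A*B = -(Real.exp (2*Real.pi*μ) : ℂ) := by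
      have e2 : (Real.exp (-(2*Real.pi*σ)):ℂ) * (Real.exp (2*Real.pi*σ):ℂ) = 1 := by
        rw [← Complex.ofReal_mul, ← Real.exp_add]; simp
      rw [← r2_c σ μ h, hA, hB]
      linear_combination -(((Real.sinh (2*Real.pi*σ):ℂ) + Complex.I * rr σ μ) * ((Real.sinh (2*Real.pi*σ):ℂ) - Complex.I * rr σ μ))*e2
    have hexp : Complex.exp (Complex.log A + Complex.log B) = Complex.exp (2*Real.pi*μ - Complex.I*Real.pi) := by
      rw [Complex.exp_add, Complex.exp_log hA0, Complex.exp_log hB0, hAB, Complex.exp_sub, mul_comm Complex.I,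
        Complex.exp_pi_mul_I]
      push_cast; ring
    obtain ⟨n, hn⟩ := Complex.exp_eq_exp_iff_exists_int.1 hexp
    have him := congrArg Complex.im hn
    have e3 : (2*Real.pi*μ - Complex.I*Real.pi + n*(2*Real.pi*Complex.I) : ℂ).im = -Real.pi + n*(2*Real.pi) := by
      simp
    rw [e3, Complex.add_im, Complex.log_im, Complex.log_im] at him
    have a1 := Complex.neg_pi_lt_arg A
    have a2 := Complex.neg_pi_lt_arg B
    have a3 := Complex.arg_neg_iff.2 hAi
    have a4 := Complex.arg_neg_iff.2 hBi
    have n0 : n = 0 := by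
      have h1 : (n:ℝ) < 1 := by nlinarith
      have h2 : (-1:ℝ) < n := by nlinarith
      have h1' : n < 1 := by exact_mod_cast h1
      have h2' : -1 < n := by exact_mod_cast h2
      omega
    rw [hn, n0]; simp
  rw [F1]
  linear_combination -Complex.I * key + Real.pi*Complex.I_sq

theorem F2_ts (σ μ : ℝ) (h : Real.sinh (2*Real.pi*σ)^2 < Real.exp (2*Real.pi*μ)) :
    F2 σ (ts σ μ) = 4*Real.pi*XX σ μ * rr σ μ / (Real.exp (2*Real.pi*μ) : ℂ) := by
  have hM := r2_c σ μ h
  have hM0 : (Real.exp (2*Real.pi*μ) : ℂ) ≠ 0 := by exact_mod_cast (Real.exp_pos _).ne'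
  rw [F2, Wf, Wf, exp_ts_add, exp_ts_sub]
  have e1 : Complex.exp (2*Real.pi*(ts σ μ + σ)) = XX σ μ * (Real.exp (2*Real.pi*σ):ℂ) := by
    rw [mul_add, Complex.exp_add, exp_ts]; push_cast; rfl
  have e2 : Complex.exp (2*Real.pi*(ts σ μ - σ)) = XX σ μ * (Real.exp (-(2*Real.pi*σ)):ℂ) := by
    rw [mul_sub, sub_eq_add_neg, Complex.exp_add, exp_ts]; push_cast; rfl
  rw [e1, e2]
  have n1 : (Real.exp (2*Real.pi*σ):ℂ) ≠ 0 := by exact_mod_cast (Real.exp_pos _).ne'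
  have n2 : (Real.exp (-(2*Real.pi*σ)):ℂ) ≠ 0 := by exact_mod_cast (Real.exp_pos _).ne'
  generalize (Real.exp (2*Real.pi*σ):ℂ) = p at *
  generalize (Real.exp (-(2*Real.pi*σ)):ℂ) = q at *
  rw [← hM] at hM0 ⊢
  have m1 := left_ne_zero_of_mul hM0
  have m2 := right_ne_zero_of_mul hM0
  generalize (Real.sinh (2*Real.pi*σ):ℂ) = s at *
  generalize XX σ μ = X at *
  field_simp
  linear_combination -4*X*(rr σ μ:ℂ)*Complex.I_sq

theorem gauss_const (σ μ : ℝ) (h : Real.sinh (2*Real.pi*σ)^2 < Real.exp (2*Real.pi*μ)) :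
    (2*Real.pi/(-F2 σ (ts σ μ)))^(1/2:ℂ) = (Real.exp (Real.pi*μ):ℂ)/
      ((Real.sqrt (2*rr σ μ):ℂ) * (Complex.I*Complex.exp (Real.pi*ts σ μ))) := by
  have hpi := Real.pi_pos
  have hr := rr_pos σ μ h
  have hlo := ts_lo σ μ
  have hhi := ts_hi σ μ h
  have hX := XX_ne σ μ
  have hr0 : (rr σ μ:ℂ) ≠ 0 := by exact_mod_cast hr.ne'
  have hp : (Real.pi:ℂ) ≠ 0 := by exact_mod_cast Real.pi_ne_zero
  have hM0 : (Real.exp (2*Real.pi*μ) : ℂ) ≠ 0 := by exact_mod_cast (Real.exp_pos _).ne'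
  set Z := (Real.exp (Real.pi*μ):ℂ)/ ((Real.sqrt (2*rr σ μ):ℂ) * (Complex.I*Complex.exp (Real.pi*ts σ μ))) with hZ
  have hsq : (Real.sqrt (2*rr σ μ):ℂ)^2 = 2*rr σ μ := by
    rw [← Complex.ofReal_pow, Real.sq_sqrt (by linarith)]; push_cast; rfl
  have hes : Complex.exp (Real.pi*ts σ μ)^2 = XX σ μ := by
    rw [← exp_ts, ← Complex.exp_nat_mul]; push_cast; ring_nf
  have hms : (Real.exp (Real.pi*μ):ℂ)^2 = (Real.exp (2*Real.pi*μ):ℂ) := by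
    rw [← Complex.ofReal_pow, ← Real.exp_nat_mul]; push_cast; ring_nf
  have hz2 : Z^2 = 2*Real.pi/(-F2 σ (ts σ μ)) := by
    rw [F2_ts σ μ h, hZ, div_pow, mul_pow, mul_pow, hsq, hes, hms, Complex.I_sq]
    field_simp
    norm_num
  have hre : 0 < Z.re := by
    have e : Z = ((Real.exp (Real.pi*μ)/Real.sqrt (2*rr σ μ) : ℝ):ℂ) * Complex.exp (-(Real.pi*ts σ μ + Real.pi/2*Complex.I)) := by
      rw [hZ, Complex.exp_neg, Complex.exp_add, Complex.exp_pi_div_two_mul_I]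
      push_cast
      rw [div_mul_eq_div_div, mul_comm Complex.I]
      simp [div_eq_mul_inv]
    rw [e, Complex.re_ofReal_mul, Complex.exp_re]
    have e4 : (-(Real.pi*ts σ μ + Real.pi/2*Complex.I) : ℂ).im = -(Real.pi*(ts σ μ).im + Real.pi/2) := by
      have : (Real.pi/2*Complex.I : ℂ).im = Real.pi/2 := by
        rw [show (Real.pi/2 : ℂ) = ((Real.pi/2:ℝ):ℂ) by push_cast; rfl, Complex.im_ofReal_mul]; simp
      rw [Complex.neg_im, Complex.add_im, this]; simp
    rw [e4]
    have : 0 < Real.cos (-(Real.pi*(ts σ μ).im + Real.pi/2)) := by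
      refine Real.cos_pos_of_mem_Ioo ⟨?_, ?_⟩ <;> nlinarith
    have h7 : 0 < Real.sqrt (2*rr σ μ) := Real.sqrt_pos.2 (by linarith)
    positivity
  rw [← hz2, one_div, Complex.sq_cpow_two_inv hre]

theorem fQ_eq (σ μ : ℝ) : fQ σ μ = Complex.I*Real.pi*(7/24 - (μ:ℂ)^2/2 + Complex.I*μ - (σ:ℂ)^2) + Complex.I*Lam μ
    + Fp σ μ (ts σ μ) := by
  have hp : (Real.pi:ℂ) ≠ 0 := by exact_mod_cast Real.pi_ne_zero
  have e1 : Complex.exp (-(2 * (Real.pi:ℂ) * (σ:ℂ))) * ((Real.cosh (2*Real.pi*σ) : ℂ) + Complex.I * (rr σ μ : ℂ))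
      = -Complex.exp (2*Real.pi*(ts σ μ - σ)) := by
    rw [mul_sub, sub_eq_add_neg, Complex.exp_add, exp_ts, XX]; ring
  have e2 : Complex.exp (2 * (Real.pi:ℂ) * (σ:ℂ)) * ((Real.cosh (2*Real.pi*σ) : ℂ) + Complex.I * (rr σ μ : ℂ))
      = -Complex.exp (2*Real.pi*(ts σ μ + σ)) := by
    rw [mul_add (2*(Real.pi:ℂ)), Complex.exp_add, exp_ts, XX]; ring
  have e3 : Complex.log (-(Real.cosh (2*Real.pi*σ) : ℂ) - Complex.I * (rr σ μ : ℂ)) = 2*Real.pi*ts σ μ := by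
    rw [ts, XX]; field_simp
  rw [fQ, ← rr, e1, e2, e3, Fp, Lam, Lam, Lam]
  generalize ts σ μ = t
  generalize Li2 _ = l1
  generalize Li2 _ = l2
  generalize Li2 _ = l3
  have hi : Complex.I ≠ 0 := Complex.I_ne_zero
  have hinv : (2 * (Real.pi:ℂ) * Complex.I)⁻¹ = -Complex.I/(2*Real.pi) := by
    rw [mul_inv, Complex.inv_I]; field_simp
  simp only [div_eq_mul_inv _ (2 * (Real.pi:ℂ) * Complex.I), hinv]
  field_simp
  ring_nf
  simp only [Complex.I_sq]
  ring


noncomputable def Hb (b σ μ : ℝ) (t : ℂ) : ℂ :=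
  Complex.exp ((Fp σ μ t + Complex.I*Eb (b^2) (t+σ) + Complex.I*Eb (b^2) (t-σ))/(b:ℂ)^2 + Real.pi*t)

noncomputable def pref (b σ μ : ℝ) : ℂ :=
  Complex.I*Real.pi*(1/6 + 7*((b:ℂ)^2+2+1/(b:ℂ)^2)/24 - (μ:ℂ)^2/(2*(b:ℂ)^2) + Complex.I*μ*(1+1/(b:ℂ)^2) - (σ:ℂ)^2/(b:ℂ)^2)
    + Complex.I*(Lam μ + Eb (b^2) μ)/(b:ℂ)^2

theorem Qfun_eq {b : ℝ} (hb : 0 < b) (hb2 : b^2 < 1/3) (σ μ : ℝ) :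
    Qfun b (σ/b) (μ/b) = Complex.exp (pref b σ μ) *
      ∫ x : ℝ, Hb b σ μ ((b*x:ℝ) + (-(3*(b^2+1)/8):ℝ)*Complex.I) := by
  have hbC : (b:ℂ) ≠ 0 := by exact_mod_cast hb.ne'
  have hμ : (μ:ℂ) ∈ St := by show |(μ:ℂ).im| < 1/2; simp
  rw [Qfun, sb, Complex.ofReal_div, Complex.ofReal_div, Lb_eq hb μ hμ, ← Complex.exp_add]
  congr 1
  · congr 1
    rw [pref, Qb]
    field_simp
    ring
  · congr 1
    ext x
    set T : ℂ := (b*x:ℝ) + (-(3*(b^2+1)/8):ℝ)*Complex.I with hT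
    have hTi : T.im = -(3*(b^2+1)/8) := by
      simp only [hT, Complex.add_im, Complex.ofReal_im, Complex.mul_im, Complex.ofReal_re, Complex.I_re, Complex.I_im]
      ring
    have hTS : T ∈ St := mem_St (by rw [hTi]; nlinarith) (by rw [hTi]; nlinarith)
    have hx : (x:ℂ) - 3*Complex.I*Qb b/8 = T/b := by
      rw [hT, Qb]; push_cast; field_simp; ring
    rw [hx, ← add_div, ← sub_div, sb, sb, Lb_eq hb _ (St_add hTS σ), Lb_eq hb _ (St_sub hTS σ),
      ← Complex.exp_add, ← Complex.exp_add, ← Complex.exp_add, Hb, Fp, Qb]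
    congr 1
    field_simp
    ring_nf
    simp only [Complex.I_sq]
    ring

theorem Eb_re_bound {C τ : ℝ} {t : ℂ} (σ : ℝ) (hC : 0 < C) (hτ : 0 < τ)
    (h1 : ‖Eb τ (t+σ)‖ ≤ C*τ^2*‖t+σ‖) (h2 : ‖Eb τ (t-σ)‖ ≤ C*τ^2*‖t-σ‖) :
    ‖(Complex.I*Eb τ (t+σ) + Complex.I*Eb τ (t-σ))/(τ:ℂ)‖ ≤ C*τ*(2*‖t‖+2*|σ|) := by
  rw [norm_div, Complex.norm_real, Real.norm_of_nonneg hτ.le, div_le_iff₀ hτ]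
  refine (norm_add_le _ _).trans ?_
  rw [norm_mul, norm_mul, Complex.norm_I, one_mul, one_mul]
  have a1 : ‖t+σ‖ ≤ ‖t‖+|σ| := by simpa using norm_add_le t (σ:ℂ)
  have a2 : ‖t-σ‖ ≤ ‖t‖+|σ| := by simpa using norm_sub_le t (σ:ℂ)
  calc _ ≤ C*τ^2*(‖t‖+|σ|) + C*τ^2*(‖t‖+|σ|) := by
        refine add_le_add (h1.trans ?_) (h2.trans ?_) <;> gcongr
    _ = _ := by ring

theorem shift_H (σ μ : ℝ) (h : Real.sinh (2*Real.pi*σ)^2 < Real.exp (2*Real.pi*μ)) :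
    ∃ b₀ > 0, ∀ b ∈ Ioo (0:ℝ) b₀, b^2 < 1/3 ∧
      ∫ x : ℝ, Hb b σ μ ((b*x:ℝ) + (-(3*(b^2+1)/8):ℝ)*Complex.I) =
      ∫ y : ℝ, Hb b σ μ (ts σ μ + (b*y:ℝ)) := by
  have hlo := ts_lo σ μ
  have hhi := ts_hi σ μ h
  set vs := (ts σ μ).im with hvs
  set v1 := min vs (-(42/100)) with hv1
  set v2 := max vs (-(3/8)) with hv2
  have h1 : -(1/2) < v1 := lt_min hlo (by norm_num)
  have h2 : v2 < -(1/4) := max_lt hhi (by norm_num)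
  have h12 : v1 ≤ v2 := (min_le_left _ _).trans (le_max_left _ _)
  obtain ⟨A, k, hk, hdec⟩ := decay σ μ v1 v2 h1 h12 h2
  obtain ⟨C, hC, hE⟩ := Eb_bound (v := -v1) (by linarith)
  set D := 2*C + Real.pi + 1 with hD
  have hpi := Real.pi_pos
  have hDp : 0 < D := by positivity
  refine ⟨min (1/10) (k/D), by positivity, fun b hb => ?_⟩
  have hb0 := hb.1
  have hb1 : b < 1/10 := hb.2.trans_le (min_le_left _ _)
  have hb2 : b < k/D := hb.2.trans_le (min_le_right _ _)
  have hτ : b^2 < 1/100 := by nlinarith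
  have hτ0 : 0 < b^2 := by positivity
  refine ⟨by linarith, ?_⟩
  have hkD : D*b^2 ≤ k := by
    rw [lt_div_iff₀ hDp] at hb2
    nlinarith
  have hkD' : D ≤ k/b^2 := by rwa [le_div_iff₀ hτ0]
  have hSt : ∀ z : ℂ, z.im ∈ Icc v1 v2 → z ∈ St := fun z hz => mem_St (by linarith [hz.1]) (by linarith [hz.2])
  have key := fun {v w : ℝ} hv hw => (shift_contour (f := Hb b σ μ) (v1 := v1) (v2 := v2) (k := 1)
    (K := Real.exp (A/b^2 + C*(1+2*|σ|))) one_pos ?_ ?_ (v := v) (w := w) hv hw).2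
  · have m1 : -(3*(b^2+1)/8) ∈ Icc v1 v2 :=
      ⟨(min_le_right _ _).trans (by linarith), le_trans (by linarith) (le_max_right _ _)⟩
    have m2 : vs ∈ Icc v1 v2 := ⟨min_le_left _ _, le_max_left _ _⟩
    have k1 := key m1 m2
    have s1 := Measure.integral_comp_mul_left (fun u : ℝ => Hb b σ μ (u + (-(3*(b^2+1)/8):ℝ)*Complex.I)) b
    have s2 := Measure.integral_comp_mul_left (fun u : ℝ => Hb b σ μ (ts σ μ + u)) b
    rw [s1, s2, k1]
    congr 1
    have s3 := integral_add_right_eq_self (μ := volume) (fun u : ℝ => Hb b σ μ (u + vs*Complex.I)) (ts σ μ).re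
    rw [← s3]
    congr 1
    ext u
    congr 1
    conv_rhs => rw [← Complex.re_add_im (ts σ μ)]
    push_cast
    ring
  · intro z hz
    have hz' := hSt z hz
    have d1 := (Fp_deriv σ μ z hz').differentiableAt
    have d2 : DifferentiableAt ℂ (fun z => Eb (b^2) (z+σ)) z :=
      DifferentiableAt.comp (g := Eb (b^2)) (f := fun z : ℂ => z+σ) z (Eb_diff hτ0 _ (St_add hz' σ)) (by fun_prop)
    have d3 : DifferentiableAt ℂ (fun z => Eb (b^2) (z-σ)) z :=
      DifferentiableAt.comp (g := Eb (b^2)) (f := fun z : ℂ => z-σ) z (Eb_diff hτ0 _ (St_sub hz' σ)) (by fun_prop)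
    unfold Hb
    fun_prop
  · intro u v hv
    set t : ℂ := u + v*Complex.I with ht
    have him : t.im = v := by simp [ht]
    have hre : t.re = u := by simp [ht]
    have hab : |v| ≤ -v1 := by rw [abs_le]; constructor <;> linarith [hv.1, hv.2]
    have e1 := hE (b^2) hτ0 (t+σ) (by simpa [him] using hab)
    have e2 := hE (b^2) hτ0 (t-σ) (by simpa [him] using hab)
    have e3 := Eb_re_bound σ hC hτ0 e1 e2
    have hn : ‖t‖ ≤ |u| + 1/2 := by
      refine (Complex.norm_le_abs_re_add_abs_im t).trans ?_
      rw [hre, him]; linarith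
    rw [Hb, Complex.norm_exp, ← Real.exp_add]
    refine Real.exp_le_exp.2 ?_
    have e4 : ((Fp σ μ t + Complex.I*Eb (b^2) (t+σ) + Complex.I*Eb (b^2) (t-σ))/(b:ℂ)^2 + Real.pi*t).re
        = (Fp σ μ t).re/b^2 + ((Complex.I*Eb (b^2) (t+σ) + Complex.I*Eb (b^2) (t-σ))/((b^2:ℝ):ℂ)).re + Real.pi*u := by
      rw [add_assoc, add_div, Complex.add_re, Complex.add_re, ← Complex.ofReal_pow, Complex.div_ofReal_re, Complex.re_ofReal_mul, hre]
    rw [e4]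
    have e5 := (Complex.re_le_norm _).trans e3
    have e6 : (Fp σ μ t).re/b^2 ≤ A/b^2 - k/b^2*|u| := by
      rw [div_mul_eq_mul_div, ← sub_div]
      exact div_le_div_of_nonneg_right (hdec u v hv) hτ0.le
    have e7 : D*|u| ≤ k/b^2*|u| := by gcongr
    have e8 : C*b^2*(2*‖t‖+2*|σ|) ≤ C*1*(2*(|u|+1/2)+2*|σ|) := by
      gcongr; linarith
    have e9 : Real.pi*u ≤ Real.pi*|u| := by gcongr; exact le_abs_self u
    rw [hD] at e7
    nlinarith

theorem lap_H (σ μ : ℝ) (h : Real.sinh (2*Real.pi*σ)^2 < Real.exp (2*Real.pi*μ)) :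
    ∃ C > 0, ∃ b₀ ∈ Ioo (0:ℝ) 1, ∀ b ∈ Ioo (0:ℝ) b₀,
      ‖(∫ y : ℝ, Complex.exp ((Fp σ μ (ts σ μ + (b*y:ℝ)) - Fp σ μ (ts σ μ))/(b:ℂ)^2
        + ((Complex.I*Eb (b^2) (ts σ μ + (b*y:ℝ)+σ) + Complex.I*Eb (b^2) (ts σ μ + (b*y:ℝ)-σ))/((b^2:ℝ):ℂ)
        + Real.pi*(b*y:ℝ) + 7*Complex.I*Real.pi*(b:ℂ)^2/24 + Complex.I*Eb (b^2) μ/((b^2:ℝ):ℂ))))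
        - (2*Real.pi/(-F2 σ (ts σ μ)))^(1/2:ℂ)‖ ≤ C*b := by
  have hlo := ts_lo σ μ
  have hhi := ts_hi σ μ h
  have hpi := Real.pi_pos
  set t0 := ts σ μ with ht0
  have him : ∀ s : ℝ, (t0 + (s:ℂ)).im = t0.im := by intro s; simp
  have hS : ∀ s : ℝ, t0 + (s:ℂ) ∈ St := fun s => mem_St (by rw [him]; exact hlo) (by rw [him]; linarith)
  have D1 : ∀ s : ℝ, HasDerivAt (fun s : ℝ => Fp σ μ (t0+s)) (F1 σ μ (t0+s)) s := fun s => line_deriv t0 s (Fp_deriv σ μ _ (hS s))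
  have D2 : ∀ s : ℝ, HasDerivAt (fun s : ℝ => F1 σ μ (t0+s)) (F2 σ (t0+s)) s := fun s => line_deriv t0 s (F1_deriv σ μ _ (hS s))
  have D3 : ∀ s : ℝ, HasDerivAt (fun s : ℝ => F2 σ (t0+s)) (F3 σ (t0+s)) s := fun s => line_deriv t0 s (F2_deriv σ _ (hS s))
  have hsad : F1 σ μ t0 = 0 := saddle σ μ h
  have hneg : ∀ s : ℝ, (F2 σ (t0+s)).re < 0 := fun s => F2_re_neg σ _ (by rw [him]; exact hlo) (by rw [him]; linarith)
  obtain ⟨m, hm, hmb⟩ : ∃ m > 0, ∀ s ∈ Icc (-1:ℝ) 1, (F2 σ (t0+s)).re ≤ -m := by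
    obtain ⟨x, hx, hmax⟩ := (isCompact_Icc (a := (-1:ℝ)) (b := 1)).exists_isMaxOn ⟨0, by simp⟩
      (f := fun s : ℝ => (F2 σ (t0+s)).re) (fun s _ => (re_deriv (D3 s)).continuousAt.continuousWithinAt)
    refine ⟨-(F2 σ (t0+x)).re, by linarith [hneg x], fun s hs => ?_⟩
    have := hmax hs
    simpa using this
  set K3 := 4*Real.pi^2*(2*(1/(2*(1+Real.cos (2*Real.pi*t0.im))))) with hK3
  have hF3 : ∀ s : ℝ, ‖F3 σ (t0+s)‖ ≤ K3 := by
    intro s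
    have b1 := Wd_bound _ (St_add (hS s) σ)
    have b2 := Wd_bound _ (St_sub (hS s) σ)
    have i1 : (t0+s+σ : ℂ).im = t0.im := by simp
    have i2 : (t0+s-σ : ℂ).im = t0.im := by simp
    rw [i1] at b1
    rw [i2] at b2
    rw [F3, norm_neg, norm_mul, hK3]
    have e : ‖Complex.I*(2*Real.pi)*(2*Real.pi)‖ = 4*Real.pi^2 := by
      simp [abs_of_pos hpi]; ring
    rw [e]
    have := norm_add_le (Wd (t0+s+σ)) (Wd (t0+s-σ))
    gcongr
    linarith
  have hK3p : 0 ≤ K3 := (norm_nonneg _).trans (hF3 0)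
  have T1 : ∀ s : ℝ, ‖F2 σ (t0+s) - F2 σ t0‖ ≤ K3*|s|^1 := by
    refine pow_int_bound hK3p 0 (fun x => (D3 x).sub_const _) (by simp) (fun x => by simpa using hF3 x)
  have T2 : ∀ s : ℝ, ‖F1 σ μ (t0+s) - s*F2 σ t0‖ ≤ K3*|s|^2 := by
    refine pow_int_bound hK3p 1 (fun x => ?_) (by simp [hsad]) T1
    refine (D2 x).sub ?_
    simpa using (Complex.ofRealCLM.hasDerivAt (x := x)).mul_const (F2 σ t0)
  have T3 : ∀ s : ℝ, ‖(Fp σ μ (t0+s) - Fp σ μ t0) - (s:ℂ)^2/2*F2 σ t0‖ ≤ K3*|s|^3 := by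
    refine pow_int_bound hK3p 2 (fun x => ?_) (by simp) T2
    refine ((D1 x).sub_const _).sub ?_
    have := ((((hasDerivAt_pow 2 (x:ℂ)).comp_ofReal).div_const 2).mul_const (F2 σ t0))
    refine this.congr_deriv ?_
    simp
  obtain ⟨q1, q2⟩ := concave_quad (g := fun s => (Fp σ μ (t0+s) - Fp σ μ t0).re) (g' := fun s => (F1 σ μ (t0+s)).re)
    (g'' := fun s => (F2 σ (t0+s)).re) (m := m) (fun s => re_deriv ((D1 s).sub_const _)) (fun s => re_deriv (D2 s))
    (fun s => (hneg s).le) hmb (by simp) (by simp [hsad])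
  obtain ⟨C, hC, hE⟩ := Eb_bound (v := -t0.im) (by linarith)
  set K := K3 + (Real.pi + 7*Real.pi/24 + C*(2*‖t0‖+2+2*|σ|+|μ|)) with hK
  have hKp : 0 < K := by positivity
  obtain ⟨C', hC', b₀, hb₀, hlap⟩ := laplace (φ := fun s : ℝ => Fp σ μ (t0+s) - Fp σ μ t0) (a := -F2 σ t0) (m := m) (K := K)
    hm hKp (by have := hmb 0 (by simp); simp at this ⊢; linarith)
    (continuous_iff_continuousAt.2 fun s => ((D1 s).sub_const _).continuousAt) q1 q2 (fun s => by
      have e : Fp σ μ (t0+s) - Fp σ μ t0 + -F2 σ t0*(s:ℂ)^2/2 = (Fp σ μ (t0+s) - Fp σ μ t0) - (s:ℂ)^2/2*F2 σ t0 := by ring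
      rw [e]
      refine (T3 s).trans ?_
      gcongr
      rw [hK]
      have : 0 ≤ Real.pi + 7*Real.pi/24 + C*(2*‖t0‖+2+2*|σ|+|μ|) := by positivity
      linarith)
  refine ⟨C', hC', b₀, hb₀, fun b hb => ?_⟩
  have hb0 := hb.1
  have hb1 : b < 1 := hb.2.trans hb₀.2
  have hτ0 : 0 < b^2 := by positivity
  have hτb : b^2 ≤ b := by nlinarith
  refine hlap b hb (fun s : ℝ => (Complex.I*Eb (b^2) (t0 + s+σ) + Complex.I*Eb (b^2) (t0 + s-σ))/((b^2:ℝ):ℂ)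
        + Real.pi*s + 7*Complex.I*Real.pi*(b:ℂ)^2/24 + Complex.I*Eb (b^2) μ/((b^2:ℝ):ℂ)) ?_ ?_
  · have c1 : Continuous (fun s : ℝ => Eb (b^2) (t0+s+σ)) := continuous_iff_continuousAt.2 fun s =>
      ContinuousAt.comp (f := fun s : ℝ => t0+(s:ℂ)+σ) (Eb_diff hτ0 _ (St_add (hS s) σ)).continuousAt (by fun_prop)
    have c2 : Continuous (fun s : ℝ => Eb (b^2) (t0+s-σ)) := continuous_iff_continuousAt.2 fun s =>
      ContinuousAt.comp (f := fun s : ℝ => t0+(s:ℂ)-σ) (Eb_diff hτ0 _ (St_sub (hS s) σ)).continuousAt (by fun_prop)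
    fun_prop
  · intro s
    have hab : |t0.im| ≤ -t0.im := by rw [abs_of_neg (by linarith)]
    have e1 := hE (b^2) hτ0 (t0+s+σ) (by simpa using hab)
    have e2 := hE (b^2) hτ0 (t0+s-σ) (by simpa using hab)
    have e3 := Eb_re_bound σ hC hτ0 e1 e2
    have e4 : ‖Complex.I*Eb (b^2) μ/((b^2:ℝ):ℂ)‖ ≤ C*b^2*|μ| := by
      rw [norm_div, norm_mul, Complex.norm_I, one_mul, Complex.norm_real, Real.norm_of_nonneg hτ0.le, div_le_iff₀ hτ0]
      refine (hE (b^2) hτ0 μ (by simp; linarith)).trans (le_of_eq ?_)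
      simp; ring
    have e5 : ‖7*Complex.I*Real.pi*(b:ℂ)^2/24‖ = 7*Real.pi/24*b^2 := by
      simp [abs_of_pos hpi]; ring
    have e6 : ‖(Real.pi:ℂ)*s‖ = Real.pi*|s| := by simp [abs_of_pos hpi]
    have hn : ‖t0+s‖ ≤ ‖t0‖+|s| := by simpa using norm_add_le t0 (s:ℂ)
    have hs := abs_nonneg s
    refine (norm_add_le _ _).trans ((add_le_add (norm_add_le _ _) le_rfl).trans ((add_le_add (add_le_add (norm_add_le _ _) le_rfl) le_rfl).trans ?_))
    rw [e5, e6]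
    have e7 : C*b^2*(2*‖t0+s‖+2*|σ|) ≤ C*b^2*(2*(‖t0‖+|s|)+2*|σ|) := by gcongr
    have e8 : C*b^2*(2*(‖t0‖+|s|)+2*|σ|) ≤ C*b*(2*‖t0‖+2*|σ|) + C*1*(2*|s|) := by
      have x1 : C*b^2*(2*‖t0‖+2*|σ|) ≤ C*b*(2*‖t0‖+2*|σ|) := by gcongr
      have x2 : C*b^2*(2*|s|) ≤ C*1*(2*|s|) := by gcongr; nlinarith
      linarith
    have e9 : C*b^2*|μ| ≤ C*b*|μ| := by gcongr
    have e10 : 7*Real.pi/24*b^2 ≤ 7*Real.pi/24*b := by gcongr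
    have z1 : 0 ≤ K3*(b+|s|) := by positivity
    have z2 : 0 ≤ Real.pi*b + 7*Real.pi/24*|s| := by positivity
    have z3 : 0 ≤ C*(2*‖t0‖+2*|σ|+|μ|)*|s| + C*2*b := by positivity
    rw [hK]
    nlinarith

theorem main_thm (σ μ : ℝ)
    (h : Real.sinh (2*Real.pi*σ)^2 < Real.exp (2*Real.pi*μ)) :
    ∃ C > (0:ℝ), ∃ b₀ ∈ Set.Ioo (0:ℝ) 1, ∀ b ∈ Set.Ioo (0:ℝ) b₀,
      ‖Qfun b (σ/b) (μ/b) * Complex.exp (-(fQ σ μ)/(b:ℂ)^2)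
        - Complex.exp ((Real.pi:ℂ)*Complex.I/4) /
            ((Real.sqrt 2 : ℂ) *
              (((Real.exp (2*Real.pi*μ) - Real.sinh (2*Real.pi*σ)^2) ^ ((1:ℝ)/4) : ℝ) : ℂ))‖
        ≤ C * b := by
  obtain ⟨C, hC, b₀, hb₀, hL⟩ := lap_H σ μ h
  obtain ⟨b₁, hb₁, hS⟩ := shift_H σ μ h
  set c0 : ℂ := 3*Real.pi*Complex.I/4 - Real.pi*μ + Real.pi*ts σ μ with hc0
  have hr := rr_pos σ μ h
  have hconst : Complex.exp ((Real.pi:ℂ)*Complex.I/4) /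
            ((Real.sqrt 2 : ℂ) *
              (((Real.exp (2*Real.pi*μ) - Real.sinh (2*Real.pi*σ)^2) ^ ((1:ℝ)/4) : ℝ) : ℂ))
      = Complex.exp c0 * (2*Real.pi/(-F2 σ (ts σ μ)))^(1/2:ℂ) := by
    rw [gauss_const σ μ h]
    have e1 : (Real.exp (2*Real.pi*μ) - Real.sinh (2*Real.pi*σ)^2) ^ ((1:ℝ)/4) = Real.sqrt (rr σ μ) := by
      rw [rr, Real.sqrt_eq_rpow, Real.sqrt_eq_rpow, ← Real.rpow_mul (by linarith)]
      norm_num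
    have e2 : Complex.exp c0 = Complex.exp ((Real.pi:ℂ)*Complex.I/4) * Complex.I * (Complex.exp (Real.pi*ts σ μ)) / (Real.exp (Real.pi*μ):ℂ) := by
      have : c0 = (Real.pi:ℂ)*Complex.I/4 + Real.pi/2*Complex.I + Real.pi*ts σ μ - Real.pi*μ := by rw [hc0]; ring
      rw [this, Complex.exp_sub, Complex.exp_add, Complex.exp_add, Complex.exp_pi_div_two_mul_I]
      push_cast; rfl
    rw [e1, e2, Real.sqrt_mul (by norm_num)]
    have n1 : (Real.exp (Real.pi*μ):ℂ) ≠ 0 := by exact_mod_cast (Real.exp_pos _).ne'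
    have n2 := Complex.exp_ne_zero (Real.pi*ts σ μ)
    have n3 := Complex.I_ne_zero
    have n4 : (Real.sqrt 2:ℂ) ≠ 0 := by exact_mod_cast (Real.sqrt_pos.2 (by norm_num : (0:ℝ) < 2)).ne'
    have n5 : (Real.sqrt (rr σ μ):ℂ) ≠ 0 := by exact_mod_cast (Real.sqrt_pos.2 hr).ne'
    rw [Complex.ofReal_mul]
    field_simp
  refine ⟨‖Complex.exp c0‖*C, by have := norm_pos_iff.2 (Complex.exp_ne_zero c0); positivity, min b₀ b₁,
    ⟨lt_min hb₀.1 hb₁, (min_le_left _ _).trans_lt hb₀.2⟩, fun b hb => ?_⟩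
  have hb0 := hb.1
  have hbC : (b:ℂ) ≠ 0 := by exact_mod_cast hb0.ne'
  obtain ⟨hτ, hsh⟩ := hS b ⟨hb.1, hb.2.trans_le (min_le_right _ _)⟩
  have hl := hL b ⟨hb.1, hb.2.trans_le (min_le_left _ _)⟩
  rw [hconst, Qfun_eq hb0 hτ, hsh]
  have hmain : Complex.exp (pref b σ μ) * (∫ y : ℝ, Hb b σ μ (ts σ μ + (b*y:ℝ))) * Complex.exp (-(fQ σ μ)/(b:ℂ)^2)
      = Complex.exp c0 * ∫ y : ℝ, Complex.exp ((Fp σ μ (ts σ μ + (b*y:ℝ)) - Fp σ μ (ts σ μ))/(b:ℂ)^2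
        + ((Complex.I*Eb (b^2) (ts σ μ + (b*y:ℝ)+σ) + Complex.I*Eb (b^2) (ts σ μ + (b*y:ℝ)-σ))/((b^2:ℝ):ℂ)
        + Real.pi*(b*y:ℝ) + 7*Complex.I*Real.pi*(b:ℂ)^2/24 + Complex.I*Eb (b^2) μ/((b^2:ℝ):ℂ))) := by
    rw [mul_right_comm, ← Complex.exp_add, ← integral_const_mul, ← integral_const_mul]
    congr 1
    ext y
    rw [Hb, ← Complex.exp_add, ← Complex.exp_add]
    congr 1
    rw [fQ_eq, pref, hc0]
    generalize Fp σ μ _ = f1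
    generalize Fp σ μ _ = f2
    generalize Eb _ (_ + _) = f3
    generalize Eb _ (_ - _) = f4
    generalize Eb _ _ = f5
    generalize Lam _ = f6
    generalize ts σ μ = t
    push_cast
    field_simp
    ring_nf
    simp only [Complex.I_sq]
    ring
  rw [hmain, ← mul_sub, norm_mul, mul_assoc (‖Complex.exp c0‖) C b]
  exact mul_le_mul_of_nonneg_left hl (norm_nonneg _)

end

/-- Semiclassical limit of `𝓠`: for `σ, μ ∈ ℝ` with `e^{2πμ} > sinh²(2πσ)`,
`𝓠(b, σ/b, μ/b) = e^{πi/4}/(√2 (e^{2πμ}-sinh²(2πσ))^{1/4}) · e^{f_𝓠(σ,μ)/b²} (1 + O(b))`. -/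
theorem semiclassical_limit_Q (σ μ : ℝ)
    (h : Real.sinh (2*Real.pi*σ)^2 < Real.exp (2*Real.pi*μ)) :
    ∃ C > (0:ℝ), ∃ b₀ ∈ Set.Ioo (0:ℝ) 1, ∀ b ∈ Set.Ioo (0:ℝ) b₀,
      ‖Qfun b (σ/b) (μ/b) * Complex.exp (-(fQ σ μ)/(b:ℂ)^2)
        - Complex.exp ((Real.pi:ℂ)*Complex.I/4) /
            ((Real.sqrt 2 : ℂ) *
              (((Real.exp (2*Real.pi*μ) - Real.sinh (2*Real.pi*σ)^2) ^ ((1:ℝ)/4) : ℝ) : ℂ))‖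
        ≤ C * b := by
  exact main_thm σ μ h
end
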